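/- arXiv:2304.10052 — 6 statements merged into one kernel-verified Lean document; each statement's English description precedes it below -/
import Mathlib

section
/- Let j and d_1,…,d_j be positive integers, d = Σ_{i=1}^j d_i, and let θ_1,…,θ_j ∈ ℝ^q be pairwise distinct. Let I = {(i,γ) : i ∈ {1,…,j}, γ ∈ ℕ^q, |γ| ≤ d_i − 1} and I_{d−1} = {α ∈ ℕ^q : |α| ≤ d − 1}. Define the real matrix A(θ_1,…,θ_j), with rows indexed by α ∈ I_{d−1} and columns indexed by (i,γ) ∈ I, by A_{α,(i,γ)} = θ_i^{α−γ}/(α−γ)! if α ≥ γ coordinatewise, and A_{α,(i,γ)} = 0 otherwise. Then: (1) A(θ_1,…,θ_j) has full column rank; and (2) for every compact subset B of {(θ_1,…,θ_j) ∈ (ℝ^q)^j : θ_i ≠ θ_ℓ for all i ≠ ℓ}, one has inf_{(θ_1,…,θ_j)∈B} inf_{w : ‖w‖_∞=1} ‖A(θ_1,…,θ_j) w‖_∞ > 0. -/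
open scoped BigOperators

noncomputable section

abbrev Euc (q : ℕ) : Type := EuclideanSpace ℝ (Fin q)

/-- Multi-indices `α ∈ ℕ^q` with `|α| ≤ n`, as a finite set. -/
def multiIdx (q n : ℕ) : Finset (Fin q → ℕ) :=
  (Fintype.piFinset fun _ : Fin q => Finset.range (n + 1)).filter fun α => (∑ j, α j) ≤ n

/-- Column index set `I = {(i,γ) : i ∈ [j], |γ| ≤ d_i - 1}`. -/
abbrev ColIdx (q j : ℕ) (d : Fin j → ℕ) : Type :=
  (i : Fin j) × {γ : Fin q → ℕ // γ ∈ multiIdx q (d i - 1)}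

/-- Row index set `I_{d-1} = {α : |α| ≤ d - 1}` where `d = Σ d_i`. -/
abbrev RowIdx (q n : ℕ) : Type := {α : Fin q → ℕ // α ∈ multiIdx q n}

/-- The matrix `A(θ_1,…,θ_j)` with entries `θ_i^{α-γ}/(α-γ)!` for `α ≥ γ`, `0` otherwise. -/
def matA {q j : ℕ} (d : Fin j → ℕ) (θ : Fin j → Euc q) :
    Matrix (RowIdx q ((∑ i, d i) - 1)) (ColIdx q j d) ℝ := fun α c =>
  if ∀ l, c.2.1 l ≤ α.1 l then
    (∏ l, (θ c.1 l) ^ (α.1 l - c.2.1 l)) / (∏ l, ((α.1 l - c.2.1 l).factorial : ℝ))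
  else 0

/-- The algebra endomorphism `P(x) ↦ P(x + t)` of the polynomial ring. -/
def polyShift {q : ℕ} (t : Fin q → ℝ) : MvPolynomial (Fin q) ℝ →ₐ[ℝ] MvPolynomial (Fin q) ℝ :=
  MvPolynomial.aeval fun l => MvPolynomial.X l + MvPolynomial.C (t l)

@[simp]
theorem polyShift_X {q : ℕ} (t : Fin q → ℝ) (l : Fin q) :
    polyShift t (MvPolynomial.X l) = MvPolynomial.X l + MvPolynomial.C (t l) := by
  simp [polyShift]

@[simp]
theorem polyShift_C {q : ℕ} (t : Fin q → ℝ) (a : ℝ) :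
    polyShift t (MvPolynomial.C a) = MvPolynomial.C a :=
  (polyShift t).commutes a

theorem constantCoeff_polyShift {q : ℕ} (t : Fin q → ℝ) (P : MvPolynomial (Fin q) ℝ) :
    MvPolynomial.constantCoeff (polyShift t P) = MvPolynomial.eval t P := by
  induction P using MvPolynomial.induction_on with
  | C a => simp
  | add p r hp hr => simp [hp, hr]
  | mul_X p l hp => simp [hp]

theorem coeff_polyShift_monomial {q : ℕ} (t : Fin q → ℝ) (α γ : Fin q →₀ ℕ) :
    MvPolynomial.coeff γ (polyShift t (MvPolynomial.monomial α 1)) =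
      ∏ l, t l ^ (α l - γ l) * ((α l).choose (γ l) : ℝ) := by
  have h : polyShift t (MvPolynomial.monomial α 1) =
      ∑ κ ∈ Fintype.piFinset fun l => Finset.range (α l + 1),
        MvPolynomial.monomial (Finsupp.equivFunOnFinite.symm κ)
          (∏ l, t l ^ (α l - κ l) * ((α l).choose (κ l) : ℝ)) := by
    rw [MvPolynomial.monomial_eq, Finsupp.prod_fintype _ _ (by simp)]
    simp only [map_prod, map_pow, polyShift_X, map_one, one_mul, add_pow]
    rw [Finset.prod_univ_sum]
    refine Finset.sum_congr rfl fun κ _ => ?_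
    rw [MvPolynomial.monomial_eq, Finsupp.prod_fintype _ _ (by simp), map_prod,
      ← Finset.prod_mul_distrib]
    refine Finset.prod_congr rfl fun l _ => ?_
    simp
    ring
  rw [h, MvPolynomial.coeff_sum]
  simp only [MvPolynomial.coeff_monomial]
  by_cases hγ : ∀ l, γ l ≤ α l
  · rw [Finset.sum_eq_single (γ : Fin q → ℕ)]
    · rw [if_pos (by ext; simp)]
    · intro κ _ hκ
      rw [if_neg]
      rintro rfl
      exact hκ (by ext; simp)
    · intro hn
      exact absurd (by simpa [Nat.lt_succ_iff] using hγ) hn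
  · push Not at hγ
    obtain ⟨l, hl⟩ := hγ
    rw [Finset.prod_eq_zero (Finset.mem_univ l) (by simp [Nat.choose_eq_zero_of_lt hl])]
    refine Finset.sum_eq_zero fun κ hκ => ?_
    rw [if_neg]
    rintro rfl
    have := Fintype.mem_piFinset.1 hκ l
    simp at this hl
    omega

theorem mem_multiIdx {q n : ℕ} {α : Fin q → ℕ} : α ∈ multiIdx q n ↔ ∑ l, α l ≤ n := by
  simp only [multiIdx, Finset.mem_filter, Fintype.mem_piFinset, Finset.mem_range,
    and_iff_right_iff_imp]
  intro h l
  exact Nat.lt_succ_of_le ((Finset.single_le_sum (fun _ _ => Nat.zero_le _)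
    (Finset.mem_univ l)).trans h)

theorem factorial_mul_matA {q j : ℕ} (d : Fin j → ℕ) (θ : Fin j → Euc q)
    (α : RowIdx q ((∑ i, d i) - 1)) (c : ColIdx q j d) :
    (∏ l, ((α.1 l).factorial : ℝ)) * matA d θ α c =
      (∏ l, ((c.2.1 l).factorial : ℝ)) *
        MvPolynomial.coeff (Finsupp.equivFunOnFinite.symm c.2.1)
          (polyShift (θ c.1) (MvPolynomial.monomial (Finsupp.equivFunOnFinite.symm α.1) 1)) := by
  rw [coeff_polyShift_monomial, matA]
  split_ifs with h
  · rw [← Finset.prod_div_distrib, ← Finset.prod_mul_distrib, ← Finset.prod_mul_distrib]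
    refine Finset.prod_congr rfl fun l _ => ?_
    have hf : ((α.1 l).factorial : ℝ) =
        (α.1 l).choose (c.2.1 l) * (c.2.1 l).factorial * (α.1 l - c.2.1 l).factorial := by
      exact_mod_cast (Nat.choose_mul_factorial_mul_factorial (h l)).symm
    have h0 : ((α.1 l - c.2.1 l).factorial : ℝ) ≠ 0 := by positivity
    rw [hf]
    simp only [Finsupp.equivFunOnFinite_symm_apply_apply]
    field_simp
  · push Not at h
    obtain ⟨l, hl⟩ := h
    rw [Finset.prod_eq_zero (f := fun l => _ * _) (Finset.mem_univ l)
      (by simp [Nat.choose_eq_zero_of_lt hl])]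
    simp

/-- A vector in the kernel of `matA d θ` annihilates all polynomials of degree `< ∑ i, d i`. -/
theorem sum_coeff_polyShift_eq_zero {q j : ℕ} (d : Fin j → ℕ) (θ : Fin j → Euc q)
    (w : ColIdx q j d → ℝ) (hw : (matA d θ).mulVec w = 0) (P : MvPolynomial (Fin q) ℝ)
    (hP : P.totalDegree ≤ (∑ i, d i) - 1) :
    ∑ c : ColIdx q j d, w c * ((∏ l, ((c.2.1 l).factorial : ℝ)) *
      MvPolynomial.coeff (Finsupp.equivFunOnFinite.symm c.2.1) (polyShift (θ c.1) P)) = 0 := by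
  have hmon : ∀ α ∈ P.support, ∑ c : ColIdx q j d, w c * ((∏ l, ((c.2.1 l).factorial : ℝ)) *
      MvPolynomial.coeff (Finsupp.equivFunOnFinite.symm c.2.1)
        (polyShift (θ c.1) (MvPolynomial.monomial α 1))) = 0 := by
    intro α hα
    have hmem : (α : Fin q → ℕ) ∈ multiIdx q ((∑ i, d i) - 1) := by
      rw [mem_multiIdx]
      have := (MvPolynomial.le_totalDegree hα).trans hP
      rwa [Finsupp.sum_fintype _ _ (by simp)] at this
    have h := congrFun hw ⟨α, hmem⟩
    have h' := congrArg (fun x : ℝ => (∏ l, ((α l).factorial : ℝ)) * x) h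
    simp only [Matrix.mulVec, dotProduct, Pi.zero_apply, mul_zero, Finset.mul_sum] at h'
    rw [← h']
    refine Finset.sum_congr rfl fun c _ => ?_
    have hc := factorial_mul_matA d θ ⟨α, hmem⟩ c
    have hα' : Finsupp.equivFunOnFinite.symm (α : Fin q → ℕ) = α := by ext; simp
    simp only [hα'] at hc
    rw [← hc]
    ring
  have hexp : ∀ c : ColIdx q j d,
      MvPolynomial.coeff (Finsupp.equivFunOnFinite.symm c.2.1) (polyShift (θ c.1) P) =
      ∑ α ∈ P.support, P.coeff α * MvPolynomial.coeff (Finsupp.equivFunOnFinite.symm c.2.1)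
        (polyShift (θ c.1) (MvPolynomial.monomial α 1)) := by
    intro c
    conv_lhs => rw [P.as_sum]
    rw [map_sum, MvPolynomial.coeff_sum]
    refine Finset.sum_congr rfl fun α _ => ?_
    rw [← mul_one (P.coeff α), ← smul_eq_mul, ← MvPolynomial.smul_monomial, map_smul,
      MvPolynomial.coeff_smul]
    simp
  simp only [hexp, Finset.mul_sum]
  rw [Finset.sum_comm]
  refine Finset.sum_eq_zero fun α hα => ?_
  rw [← mul_zero (P.coeff α), ← hmon α hα, Finset.mul_sum]
  refine Finset.sum_congr rfl fun c _ => ?_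
  ring

/-- Hermite-type dual polynomial: for each column `c₀` there is a polynomial of degree
`< ∑ i, d i` vanishing to order `d i` at `θ i` for `i ≠ c₀.1` and behaving like a nonzero multiple
of `(x - θ c₀.1) ^ c₀.2` at `θ c₀.1`. -/
theorem exists_dual_polynomial {q j : ℕ} (d : Fin j → ℕ) (hd : ∀ i, 1 ≤ d i)
    (θ : Fin j → Euc q) (hθ : Function.Injective θ) (c₀ : ColIdx q j d) :
    ∃ P : MvPolynomial (Fin q) ℝ, P.totalDegree ≤ (∑ i, d i) - 1 ∧
      MvPolynomial.coeff (Finsupp.equivFunOnFinite.symm c₀.2.1) (polyShift (θ c₀.1) P) ≠ 0 ∧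
      ∀ c : ColIdx q j d, c ≠ c₀ → (c.1 = c₀.1 → ∑ l, c.2.1 l ≤ ∑ l, c₀.2.1 l) →
        MvPolynomial.coeff (Finsupp.equivFunOnFinite.symm c.2.1) (polyShift (θ c.1) P) = 0 := by
  obtain ⟨i₀, γ₀, hγ₀⟩ := c₀
  have hsep : ∀ i : Fin j, ∃ m : Option (Fin q), i ≠ i₀ → ∃ l, m = some l ∧ θ i l ≠ θ i₀ l := by
    intro i
    by_cases hi : i = i₀
    · exact ⟨none, fun h => absurd hi h⟩
    · have : ∃ l, θ i l ≠ θ i₀ l := by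
        by_contra! h
        exact hi (hθ (by ext l; exact h l))
      obtain ⟨l, hl⟩ := this
      exact ⟨some l, fun _ => ⟨l, rfl, hl⟩⟩
  choose m hm using hsep
  let F : Fin j → MvPolynomial (Fin q) ℝ := fun i =>
    (m i).elim 1 fun l => (MvPolynomial.X l - MvPolynomial.C (θ i l)) ^ d i
  let Q : MvPolynomial (Fin q) ℝ := ∏ i ∈ Finset.univ.erase i₀, F i
  let M : MvPolynomial (Fin q) ℝ :=
    ∏ l, (MvPolynomial.X l - MvPolynomial.C (θ i₀ l)) ^ γ₀ l
  have hlin : ∀ (l : Fin q) (a : ℝ) (n : ℕ),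
      ((MvPolynomial.X l - MvPolynomial.C a : MvPolynomial (Fin q) ℝ) ^ n).totalDegree ≤ n := by
    intro l a n
    refine (MvPolynomial.totalDegree_pow _ _).trans ?_
    have : (MvPolynomial.X l - MvPolynomial.C a : MvPolynomial (Fin q) ℝ).totalDegree ≤ 1 :=
      (MvPolynomial.totalDegree_sub_C_le _ _).trans (MvPolynomial.totalDegree_X l).le
    nlinarith
  have hMtr : polyShift (θ i₀) M =
      MvPolynomial.monomial (Finsupp.equivFunOnFinite.symm γ₀) 1 := by
    rw [MvPolynomial.monomial_eq, Finsupp.prod_fintype _ _ (by simp)]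
    simp [M]
  have hQ0 : MvPolynomial.eval (θ i₀) Q ≠ 0 := by
    simp only [Q, map_prod]
    refine Finset.prod_ne_zero_iff.2 fun i hi => ?_
    obtain ⟨l, hl, hne⟩ := hm i (Finset.ne_of_mem_erase hi)
    simp only [F, hl, Option.elim_some, map_pow, map_sub, MvPolynomial.eval_X,
      MvPolynomial.eval_C]
    exact pow_ne_zero _ (sub_ne_zero.2 hne.symm)
  refine ⟨M * Q, ?_, ?_, ?_⟩
  · refine (MvPolynomial.totalDegree_mul _ _).trans ?_
    have h1 : M.totalDegree ≤ d i₀ - 1 :=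
      ((MvPolynomial.totalDegree_finsetProd _ _).trans
        (Finset.sum_le_sum fun l _ => hlin l _ _)).trans (mem_multiIdx.1 hγ₀)
    have h2 : Q.totalDegree ≤ ∑ i ∈ Finset.univ.erase i₀, d i := by
      refine (MvPolynomial.totalDegree_finsetProd _ _).trans (Finset.sum_le_sum fun i hi => ?_)
      obtain ⟨l, hl, -⟩ := hm i (Finset.ne_of_mem_erase hi)
      simpa only [F, hl, Option.elim_some] using hlin l _ _
    have h3 := Finset.add_sum_erase Finset.univ d (Finset.mem_univ i₀)
    have := hd i₀
    omega
  · rw [map_mul, hMtr, MvPolynomial.coeff_monomial_mul', if_pos le_rfl, tsub_self, one_mul,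
      ← MvPolynomial.constantCoeff_eq, constantCoeff_polyShift]
    exact hQ0
  · rintro ⟨i, γ, hγ⟩ hne hle
    by_cases hi : i = i₀
    · subst hi
      rw [map_mul, hMtr, MvPolynomial.coeff_monomial_mul', if_neg]
      intro h
      have h' : ∀ l, γ₀ l ≤ γ l := fun l => h l
      have hsum := hle rfl
      apply hne
      have : γ = γ₀ := by
        have heq := (Finset.sum_eq_sum_iff_of_le (s := Finset.univ) fun l _ => h' l).1
          (le_antisymm (Finset.sum_le_sum fun l _ => h' l) hsum)
        ext l
        exact (heq l (Finset.mem_univ l)).symm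
      subst this
      rfl
    · obtain ⟨l, hl, -⟩ := hm i hi
      have hF : polyShift (θ i) (F i) = MvPolynomial.monomial (Finsupp.single l (d i)) 1 := by
        simp [F, hl, MvPolynomial.X_pow_eq_monomial]
      have hQ : Q = F i * ∏ k ∈ (Finset.univ.erase i₀).erase i, F k :=
        (Finset.mul_prod_erase _ _ (by simp [hi])).symm
      rw [hQ, mul_left_comm, map_mul, hF, MvPolynomial.coeff_monomial_mul', if_neg]
      intro h
      have h1 : d i ≤ γ l := by simpa using h l
      have h2 := mem_multiIdx.1 hγ
      have h3 := Finset.single_le_sum (f := γ) (fun _ _ => Nat.zero_le _) (Finset.mem_univ l)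
      have := hd i
      omega

theorem eq_zero_of_matA_mulVec_eq_zero {q j : ℕ} (d : Fin j → ℕ) (hd : ∀ i, 1 ≤ d i)
    (θ : Fin j → Euc q) (hθ : Function.Injective θ) (w : ColIdx q j d → ℝ)
    (hw : (matA d θ).mulVec w = 0) : w = 0 := by
  by_contra hne
  obtain ⟨c₁, hc₁⟩ := Function.ne_iff.1 hne
  obtain ⟨c₀, hc₀, hmax⟩ := Finset.exists_max_image
    (Finset.univ.filter fun c : ColIdx q j d => w c ≠ 0) (fun c => ∑ l, c.2.1 l)
    ⟨c₁, by simpa using hc₁⟩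
  obtain ⟨P, hdeg, hP0, hP⟩ := exists_dual_polynomial d hd θ hθ c₀
  have h := sum_coeff_polyShift_eq_zero d θ w hw P hdeg
  rw [Finset.sum_eq_single c₀] at h
  · have hfac : (∏ l, ((c₀.2.1 l).factorial : ℝ)) ≠ 0 := by positivity
    exact mul_ne_zero (by simpa using hc₀) (mul_ne_zero hfac hP0) h
  · intro c _ hc
    by_cases hwc : w c = 0
    · simp [hwc]
    · rw [hP c hc fun _ => hmax c (by simpa using hwc)]
      simp
  · simp

theorem continuous_matA {q j : ℕ} (d : Fin j → ℕ) :
    Continuous fun θ : Fin j → Euc q => matA d θ := by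
  refine continuous_matrix fun α c => ?_
  simp only [matA]
  split_ifs
  · fun_prop
  · fun_prop

/-- `A(θ_1,…,θ_j)` has full column rank for pairwise distinct `θ_i`, and the
smallest sup-norm gain of `A` is uniformly bounded below on compact sets of distinct tuples. -/
theorem matA_full_column_rank_and_uniform_bound {q j : ℕ} (hj : 0 < j)
    (d : Fin j → ℕ) (hd : ∀ i, 1 ≤ d i) :
    (∀ θ : Fin j → Euc q, Function.Injective θ →
      Function.Injective (matA d θ).mulVec) ∧
    (∀ B : Set (Fin j → Euc q), IsCompact B → (∀ θ ∈ B, Function.Injective θ) →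
      ∃ ε > (0:ℝ), ∀ θ ∈ B, ∀ w : ColIdx q j d → ℝ, ‖w‖ = 1 →
        ε ≤ ‖(matA d θ).mulVec w‖) := by
  refine ⟨fun θ hθ w w' h => ?_, fun B hB hinj => ?_⟩
  · refine sub_eq_zero.1 (eq_zero_of_matA_mulVec_eq_zero d hd θ hθ (w - w') ?_)
    rw [Matrix.mulVec_sub, sub_eq_zero]
    exact h
  · let f : (Fin j → Euc q) × (ColIdx q j d → ℝ) → ℝ := fun p => ‖(matA d p.1).mulVec p.2‖
    have hf : Continuous f :=
      (((continuous_matA d).comp continuous_fst).matrix_mulVec continuous_snd).norm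
    obtain ⟨ε, hε, hle⟩ := (hB.prod (isCompact_sphere (0 : ColIdx q j d → ℝ) 1)).exists_forall_le'
      (f := f) hf.continuousOn (a := 0) (by
        rintro ⟨θ, w⟩ ⟨hθ, hw⟩
        refine norm_pos_iff.2 fun h0 => ?_
        have := eq_zero_of_matA_mulVec_eq_zero d hd θ (hinj θ hθ) w h0
        simp [this] at hw)
    exact ⟨ε, hε, fun θ hθ w hw => hle (θ, w) ⟨hθ, by simpa using hw⟩⟩


end
end

section
/- Let X be a metrizable topological space equipped with its Borel σ-algebra, let H be a real Hilbert space, and let Φ : X → H be a bounded strongly measurable map (sup_{x∈X} ‖Φ(x)‖_H < ∞). Suppose that every bounded continuous function g : X → ℝ is a uniform limit of functions of the form x ↦ ⟨h, Φ(x)⟩ with h ∈ H, i.e., for every ε > 0 there exists h ∈ H with sup_{x∈X} |g(x) − ⟨h, Φ(x)⟩| ≤ ε. Then the mean embedding μ(P) := ∫_X Φ(x) dP(x) (Bochner integral) is injective on the space of finite signed Borel measures on X: if P and Q are finite signed Borel measures with μ(P) = μ(Q), then P = Q. -/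
open MeasureTheory
open scoped RealInnerProductSpace

noncomputable section

/-- Integral of a Banach-valued map against a finite signed measure, via the Jordan
decomposition: `∫ Φ dP := ∫ Φ dP⁺ - ∫ Φ dP⁻` (Bochner integrals). -/
def signedBochner {X H : Type*} [MeasurableSpace X]
    [NormedAddCommGroup H] [NormedSpace ℝ H] [CompleteSpace H]
    (P : SignedMeasure X) (Φ : X → H) : H :=
  (∫ x, Φ x ∂P.toJordanDecomposition.posPart) - ∫ x, Φ x ∂P.toJordanDecomposition.negPart

/-- A finite Borel measure on a metrizable space is determined by the Bochner integral of a bounded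
strongly measurable map into a Hilbert space whose scalar projections are uniformly dense in the
bounded continuous functions. -/
theorem measure_eq_of_integral_eq {X H : Type*}
    [TopologicalSpace X] [HasOuterApproxClosed X] [MeasurableSpace X] [BorelSpace X]
    [NormedAddCommGroup H] [InnerProductSpace ℝ H] [CompleteSpace H]
    {Φ : X → H} (hΦmeas : StronglyMeasurable Φ) {M : ℝ} (hΦbdd : ∀ x, ‖Φ x‖ ≤ M)
    (hdense : ∀ g : X → ℝ, Continuous g → (∃ C, ∀ x, |g x| ≤ C) →
      ∀ ε > (0:ℝ), ∃ h : H, ∀ x, |g x - ⟪h, Φ x⟫| ≤ ε)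
    {μ ν : Measure X} [IsFiniteMeasure μ] [IsFiniteMeasure ν]
    (hμν : ∫ x, Φ x ∂μ = ∫ x, Φ x ∂ν) : μ = ν := by
  have hint (ρ : Measure X) [IsFiniteMeasure ρ] : Integrable Φ ρ :=
    .of_bound hΦmeas.aestronglyMeasurable M (.of_forall hΦbdd)
  refine ext_of_forall_integral_eq_of_IsFiniteMeasure fun f ↦ ?_
  have approx (ε : ℝ) (hε : 0 < ε) :
      |∫ x, f x ∂μ - ∫ x, f x ∂ν| ≤ ε * (μ.real Set.univ + ν.real Set.univ) := by
    obtain ⟨h, hh⟩ := hdense f f.continuous ⟨‖f‖, f.norm_coe_le_norm⟩ ε hε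
    have bound (ρ : Measure X) [IsFiniteMeasure ρ] :
        |∫ x, f x ∂ρ - ⟪h, ∫ x, Φ x ∂ρ⟫| ≤ ε * ρ.real Set.univ := by
      rw [← integral_inner (hint ρ) h, ← integral_sub (f.integrable ρ) ((hint ρ).const_inner h)]
      exact norm_integral_le_of_norm_le_const (f := fun x ↦ f x - ⟪h, Φ x⟫) (.of_forall hh)
    have hμ := abs_le.mp (bound μ)
    have hν := abs_le.mp (bound ν)
    rw [hμν] at hμ
    exact abs_le.mpr ⟨by linarith, by linarith⟩
  have hlim : Filter.Tendsto (fun ε : ℝ ↦ ε * (μ.real Set.univ + ν.real Set.univ))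
      (nhdsWithin 0 (Set.Ioi 0)) (nhds 0) :=
    tendsto_nhdsWithin_of_tendsto_nhds <| by
      simpa using (continuous_mul_const (μ.real Set.univ + ν.real Set.univ)).tendsto 0
  have hle := ge_of_tendsto hlim (eventually_nhdsWithin_of_forall approx)
  exact sub_eq_zero.mp (abs_nonpos_iff.mp hle)

/-- injectivity of the mean embedding on finite signed Borel measures. -/
theorem mean_embedding_injective {X H : Type*}
    [TopologicalSpace X] [TopologicalSpace.MetrizableSpace X]
    [MeasurableSpace X] [BorelSpace X]
    [NormedAddCommGroup H] [InnerProductSpace ℝ H] [CompleteSpace H]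
    (Φ : X → H) (hΦmeas : StronglyMeasurable Φ)
    (M : ℝ) (hΦbdd : ∀ x, ‖Φ x‖ ≤ M)
    (hdense : ∀ g : X → ℝ, Continuous g → (∃ C, ∀ x, |g x| ≤ C) →
      ∀ ε > (0:ℝ), ∃ h : H, ∀ x, |g x - ⟪h, Φ x⟫| ≤ ε)
    (P Q : SignedMeasure X)
    (hPQ : signedBochner P Φ = signedBochner Q Φ) :
    P = Q := by
  have hint (ρ : Measure X) [IsFiniteMeasure ρ] : Integrable Φ ρ :=
    .of_bound hΦmeas.aestronglyMeasurable M (.of_forall hΦbdd)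
  have key : P.toJordanDecomposition.posPart + Q.toJordanDecomposition.negPart =
      Q.toJordanDecomposition.posPart + P.toJordanDecomposition.negPart := by
    refine measure_eq_of_integral_eq hΦmeas hΦbdd hdense ?_
    rw [integral_add_measure (hint _) (hint _), integral_add_measure (hint _) (hint _)]
    exact sub_eq_sub_iff_add_eq_add.mp hPQ
  ext s hs
  have hreal := congrArg (fun ρ : Measure X ↦ ρ.real s) key
  beta_reduce at hreal
  rw [measureReal_add_apply, measureReal_add_apply] at hreal
  rw [P.apply_eq_posPart_real_sub_negPart_real hs, Q.apply_eq_posPart_real_sub_negPart_real hs]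
  linarith

end
end

section
/- Let m ≥ 0 be an integer and let f : ℝ → ℝ be a probability density with respect to Lebesgue measure (f ≥ 0 and ∫f dx = 1) such that f is m-times differentiable at every x ∈ ℝ and the j-th derivative f^{(j)} is Lebesgue integrable for each j ∈ {1,…,m}. Then the location family p(x | θ) = f(x − θ) is m-strongly identifiable: for every ℓ ≥ 1, every pairwise distinct θ_1,…,θ_ℓ ∈ ℝ, and every collection of real numbers a_{ij} (i ∈ {1,…,ℓ}, 0 ≤ j ≤ m), if Σ_{i=1}^ℓ Σ_{j=0}^m a_{ij} f^{(j)}(x − θ_i) = 0 for Lebesgue-a.e. x ∈ ℝ, then a_{ij} = 0 for all i and j. -/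
open MeasureTheory
open scoped BigOperators

noncomputable section

open Filter Topology Polynomial FourierTransform Complex

/-- Exponential polynomials with distinct frequencies vanish identically only if all their
polynomial coefficients vanish. -/
lemma eq_zero_of_sum_eval_mul_exp_eq_zero {ι : Type*} [Fintype ι] {θ : ι → ℝ}
    (hθ : Function.Injective θ) (P : ι → ℝ[X])
    (h : ∀ s : ℝ, ∑ i, (P i).eval s * Real.exp (-(θ i * s)) = 0) (i : ι) : P i = 0 := by
  classical
  by_contra hi
  obtain ⟨k, hk, hmin⟩ := (Finset.univ.filter fun i => P i ≠ 0).exists_min_image θ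
    ⟨i, by simpa using hi⟩
  have hk0 : P k ≠ 0 := by simpa using hk
  have hdecay : ∀ l ∈ Finset.univ.erase k,
      Tendsto (fun s : ℝ => (P l).eval s * Real.exp (-((θ l - θ k) * s))) atTop (𝓝 0) := by
    intro l hl
    by_cases hl0 : P l = 0
    · simp [hl0]
    have hc : 0 < θ l - θ k := sub_pos.2 <|
      lt_of_le_of_ne (hmin l (by simpa using hl0)) (hθ.ne (Finset.ne_of_mem_erase hl).symm)
    have hscaled := (((P l).comp (C (θ l - θ k)⁻¹ * X)).tendsto_div_exp_atTop).comp
      (tendsto_id.const_mul_atTop hc)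
    refine hscaled.congr fun s => ?_
    simp only [Function.comp_apply, id, eval_comp, eval_mul, eval_C, eval_X, Real.exp_neg,
      inv_mul_cancel_left₀ hc.ne', div_eq_mul_inv]
  have hlim : Tendsto (fun s : ℝ => (P k).eval s) atTop (𝓝 0) := by
    have := (tendsto_finsetSum _ hdecay).neg
    simp only [Finset.sum_const_zero, neg_zero] at this
    refine this.congr fun s => ?_
    have hs : ∑ l, (P l).eval s * Real.exp (-((θ l - θ k) * s)) = 0 := by
      rw [← mul_zero (Real.exp (θ k * s)), ← h s, Finset.mul_sum]
      refine Finset.sum_congr rfl fun l _ => ?_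
      rw [mul_left_comm, ← Real.exp_add]
      congr 2
      ring
    rw [← Finset.add_sum_erase _ _ (Finset.mem_univ k)] at hs
    simp only [sub_self, zero_mul, neg_zero, Real.exp_zero, mul_one] at hs
    linarith
  exact hk0 (leadingCoeff_eq_zero.1 ((P k).tendsto_nhds_iff.1 hlim).1)

/-- The Fourier transform of an integrable function on `ℝ` is continuous. -/
lemma continuous_fourier_of_integrable {g : ℝ → ℂ} (hg : Integrable g) : Continuous (𝓕 g) :=
  VectorFourier.fourierIntegral_continuous Real.continuous_fourierChar
    (by fun_prop) hg

/-- The Fourier transform turns translation into multiplication by a character. -/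
lemma fourier_comp_sub_right (g : ℝ → ℂ) (t w : ℝ) :
    𝓕 (fun x => g (x - t)) w = cexp (-(t * (2 * Real.pi * I * w))) * 𝓕 g w := by
  have h := congrFun (VectorFourier.fourierIntegral_comp_add_right Real.fourierChar volume
    (innerₗ ℝ) g (-t)) w
  simp only [← sub_eq_add_neg] at h
  refine h.trans ?_
  rw [Circle.smul_def, Real.fourierChar_apply, smul_eq_mul]
  congr 2
  simp
  ring

/-- The Fourier transform of the `j`-th derivative of a function with integrable derivatives up to
order `m`, without assuming that the last derivative is continuous. -/
lemma fourier_ofReal_iteratedDeriv {m : ℕ} {f : ℝ → ℝ}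
    (hdiff : ∀ j < m, Differentiable ℝ (iteratedDeriv j f))
    (hint : ∀ j ≤ m, Integrable (iteratedDeriv j f)) (w : ℝ) {j : ℕ} (hj : j ≤ m) :
    𝓕 (fun x => ((iteratedDeriv j f x : ℝ) : ℂ)) w =
      (2 * Real.pi * I * w) ^ j * 𝓕 (fun x => (f x : ℂ)) w := by
  induction j with
  | zero => simp
  | succ j ih =>
    have hd : deriv (fun x => ((iteratedDeriv j f x : ℝ) : ℂ)) =
        fun x => ((iteratedDeriv (j + 1) f x : ℝ) : ℂ) := by
      funext x
      rw [iteratedDeriv_succ]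
      exact (hdiff j hj x).hasDerivAt.ofReal_comp.deriv
    have h := congrFun (Real.fourier_deriv (hint j (by lia)).ofReal
      (fun x => (hdiff j hj x).hasDerivAt.ofReal_comp.differentiableAt)
      (by rw [hd]; exact (hint (j + 1) hj).ofReal)) w
    rw [hd] at h
    rw [h, smul_eq_mul, ih (by lia)]
    ring

/-- a location family generated by an `m`-times differentiable probability
density with integrable derivatives is `m`-strongly identifiable: the translates of
`f, f', …, f^{(m)}` by distinct shifts are linearly independent (a.e.). -/
theorem location_family_strongly_identifiable (m : ℕ) (f : ℝ → ℝ)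
    (hf_nonneg : ∀ x, 0 ≤ f x)
    (hf_int : Integrable f)
    (hf_mass : (∫ x, f x) = 1)
    (hf_diff : ∀ j < m, Differentiable ℝ (iteratedDeriv j f))
    (hf_der_int : ∀ j, 1 ≤ j → j ≤ m → Integrable (iteratedDeriv j f)) :
    ∀ ℓ : ℕ, 0 < ℓ → ∀ θ : Fin ℓ → ℝ, Function.Injective θ →
      ∀ a : Fin ℓ → Fin (m + 1) → ℝ,
        (∀ᵐ x ∂(volume : Measure ℝ),
          (∑ i, ∑ j, a i j * iteratedDeriv (j : ℕ) f (x - θ i)) = 0) →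
        ∀ i j, a i j = 0 := by
  intro ℓ _ θ hθ a h
  have hint : ∀ j ≤ m, Integrable (iteratedDeriv j f) := by
    intro j hj
    rcases j.eq_zero_or_pos with rfl | hj0
    · simpa using hf_int
    · exact hf_der_int j hj0 hj
  let G : ℂ → ℂ := fun z => ∑ i, (∑ j, (a i j : ℂ) * z ^ (j : ℕ)) * cexp (-(θ i * z))
  have hprod : ∀ w : ℝ, G (2 * Real.pi * I * w) * 𝓕 (fun x => (f x : ℂ)) w = 0 := by
    intro w
    have hterm : ∀ i (j : Fin (m + 1)),
        Integrable fun x => (a i j : ℂ) * ((iteratedDeriv (j : ℕ) f (x - θ i) : ℝ) : ℂ) := fun i j =>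
      ((hint j (by lia)).comp_sub_right (θ i)).ofReal.const_mul _
    have hconv : ∀ g : ℝ → ℂ, Integrable g →
        Integrable fun x => (Real.fourierChar (-(x * w)) : ℂ) * g x := fun g hg => by
      simpa [mul_comm, Circle.smul_def] using (Real.fourierIntegral_convergent_iff w).2 hg
    have hzero : 𝓕 (fun x => ∑ i, ∑ j, (a i j : ℂ) * ((iteratedDeriv (j : ℕ) f (x - θ i) : ℝ) : ℂ)) w = 0 := by
      rw [Real.fourier_congr_ae (f₂ := fun _ => 0), Real.fourier_real_eq]
      · simp
      · filter_upwards [h] with x hx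
        exact_mod_cast hx
    rw [← hzero, Real.fourier_real_eq (fun x => ∑ i, ∑ j, _)]
    simp only [Circle.smul_def, smul_eq_mul, Finset.mul_sum]
    rw [integral_finsetSum _ fun i _ => integrable_finsetSum _ fun j _ => hconv _ (hterm i j)]
    simp only [G, Finset.sum_mul]
    refine Finset.sum_congr rfl fun i _ => ?_
    rw [integral_finsetSum _ fun j _ => hconv _ (hterm i j)]
    refine Finset.sum_congr rfl fun j _ => ?_
    have hshift := fourier_comp_sub_right (fun x => ((iteratedDeriv j f x : ℝ) : ℂ)) (θ i) w
    rw [fourier_ofReal_iteratedDeriv hf_diff hint w (by lia), Real.fourier_real_eq] at hshift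
    simp only [Circle.smul_def, smul_eq_mul] at hshift
    simp only [mul_left_comm _ (a i j : ℂ)]
    rw [integral_const_mul, hshift]
    ring
  have hne : ∀ᶠ w : ℝ in 𝓝 0, 𝓕 (fun x => (f x : ℂ)) w ≠ 0 := by
    refine (continuous_fourier_of_integrable hf_int.ofReal).continuousAt.eventually_ne ?_
    rw [Real.fourier_real_eq]
    simp [integral_complex_ofReal, hf_mass]
  have hline : Tendsto (fun w : ℝ => 2 * Real.pi * I * (w : ℂ)) (𝓝[≠] 0) (𝓝[≠] 0) := by
    refine tendsto_nhdsWithin_iff.2 ⟨?_, ?_⟩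
    · refine Tendsto.mono_left ?_ nhdsWithin_le_nhds
      exact Continuous.tendsto' (by fun_prop) _ _ (by simp)
    · filter_upwards [self_mem_nhdsWithin] with w hw
      simpa [Real.pi_ne_zero] using hw
  have hfreq : ∃ᶠ z in 𝓝[≠] (0 : ℂ), G z = 0 := by
    refine hline.frequently (Eventually.frequently ?_)
    filter_upwards [nhdsWithin_le_nhds hne] with w hw
    exact (mul_eq_zero.1 (hprod w)).resolve_right hw
  have hG : AnalyticOnNhd ℂ G Set.univ :=
    DifferentiableOn.analyticOnNhd (by fun_prop) isOpen_univ
  have hG0 : G = 0 := hG.eq_of_frequently_eq (fun _ _ => analyticAt_const) hfreq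
  have hP := eq_zero_of_sum_eval_mul_exp_eq_zero hθ
    (fun i => ∑ j : Fin (m + 1), C (a i j) * X ^ (j : ℕ)) fun s => by
      have := congrFun hG0 (s : ℂ)
      simp only [G, Pi.zero_apply] at this
      simp only [eval_finsetSum, eval_mul, eval_C, eval_pow, eval_X]
      exact_mod_cast this
  intro i j
  simpa [finsetSum_coeff, coeff_X_pow, Fin.val_inj] using congrArg (coeff · (j : ℕ)) (hP i)


end
end

section
/- Let Θ ⊆ ℝ^q be compact, let k ≥ 1 be an integer and θ0 ∈ ℝ^q. Then: (i) there exists c > 0 such that max_{α ∈ ℕ^q, |α| ≤ 2k−1} |m_α(G − θ0) − m_α(H − θ0)| ≥ c · W_{2k−1}(G,H)^{2k−1} for all G ≠ H ∈ G_k(Θ); and (ii) for every 1 ≤ k0 ≤ k, setting d1 = k − k0 + 1, and every G0 ∈ E_{k0}(Θ), there exist r > 0 and c' > 0 such that max_{|α| ≤ 2k−1} |m_α(G − θ0) − m_α(H − θ0)| ≥ c' · W_{2d1−1}(G,H)^{2d1−1} whenever G ≠ H ∈ G_k(Θ) satisfy W_1(G,G0) ≤ r and W_1(H,G0) ≤ r.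 -/
open scoped BigOperators ENNReal

noncomputable section

def IsMixingMeasure {q : ℕ} (Θ : Set (Euc q)) (G : Euc q →₀ ℝ) : Prop :=
  (∀ x ∈ G.support, 0 < G x) ∧ (∑ x ∈ G.support, G x) = 1 ∧ ↑G.support ⊆ Θ

/-- `E_k(Θ)`: discrete probability measures on `Θ` with exactly `k` atoms. -/
def MixE {q : ℕ} (Θ : Set (Euc q)) (k : ℕ) (G : Euc q →₀ ℝ) : Prop :=
  IsMixingMeasure Θ G ∧ G.support.card = k

/-- `G_k(Θ)`: discrete probability measures on `Θ` with at most `k` atoms. -/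
def MixG {q : ℕ} (Θ : Set (Euc q)) (k : ℕ) (G : Euc q →₀ ℝ) : Prop :=
  IsMixingMeasure Θ G ∧ G.support.card ≤ k

/-- `Gφ = ∑ᵢ pᵢ φ(θᵢ)`. -/
def mixInt {q : ℕ} (G : Euc q →₀ ℝ) (φ : Euc q → ℝ) : ℝ :=
  ∑ x ∈ G.support, G x * φ x

def IsCoupling {q : ℕ} (G H : Euc q →₀ ℝ) (π : Euc q × Euc q → ℝ) : Prop :=
  (∀ p, 0 ≤ π p) ∧
  (∀ x ∈ G.support, (∑ y ∈ H.support, π (x, y)) = G x) ∧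
  (∀ y ∈ H.support, (∑ x ∈ G.support, π (x, y)) = H y)

/-- `Wpow ℓ G H = W_ℓ(G,H)^ℓ`, the minimal transport cost with cost `‖θ-θ'‖^ℓ`. -/
def Wpow {q : ℕ} (ℓ : ℝ) (G H : Euc q →₀ ℝ) : ℝ :=
  sInf { c | ∃ π : Euc q × Euc q → ℝ, IsCoupling G H π ∧
    c = ∑ p ∈ G.support ×ˢ H.support, π p * ‖p.1 - p.2‖ ^ ℓ }

/-- `sup_{φ ∈ Φ} |Gφ - Hφ|`, valued in `ℝ≥0∞`. -/
def phiDist {q : ℕ} (Φ : Set (Euc q → ℝ)) (G H : Euc q →₀ ℝ) : ℝ≥0∞ :=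
  ⨆ φ ∈ Φ, ENNReal.ofReal |mixInt G φ - mixInt H φ|

def pderivSeq {q : ℕ} : List (Fin q) → (Euc q → ℝ) → (Euc q → ℝ)
  | [], f => f
  | i :: l, f => pderivSeq l fun x => fderiv ℝ f x (EuclideanSpace.single i 1)

/-- The partial derivative `D^α` of multi-order `α`. -/
def Dmulti {q : ℕ} (α : Fin q → ℕ) (f : Euc q → ℝ) : Euc q → ℝ :=
  pderivSeq ((List.finRange q).flatMap fun i => List.replicate (α i) i) f


/-- The shifted moment `m_α(G - θ0) = ∑ᵢ pᵢ (θᵢ - θ0)^α`. -/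
def momentShift {q : ℕ} (θ0 : Euc q) (α : Fin q → ℕ) (G : Euc q →₀ ℝ) : ℝ :=
  ∑ x ∈ G.support, G x * ∏ j, (x j - θ0 j) ^ (α j)

/-- The monomial `x ↦ (x - θ0)^α`. -/
def shiftedMonomial {q : ℕ} (θ0 : Euc q) (α : Fin q → ℕ) (x : Euc q) : ℝ :=
  ∏ j, (x j - θ0 j) ^ (α j)

/-- Integration against the signed measure `G - H`. -/
def mixDiff {q : ℕ} (G H : Euc q →₀ ℝ) : (Euc q → ℝ) →ₗ[ℝ] ℝ where
  toFun φ := mixInt G φ - mixInt H φ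
  map_add' φ ψ := by
    simp only [mixInt, Pi.add_apply, mul_add, Finset.sum_add_distrib]
    ring
  map_smul' c φ := by
    simp only [mixInt, Pi.smul_apply, smul_eq_mul, RingHom.id_apply, mul_sub, Finset.mul_sum]
    congr 1 <;> exact Finset.sum_congr rfl fun x _ => by ring

lemma mixDiff_congr {q : ℕ} (G H : Euc q →₀ ℝ) {φ ψ : Euc q → ℝ}
    (h : ∀ x ∈ G.support ∪ H.support, φ x = ψ x) : mixDiff G H φ = mixDiff G H ψ := by
  change mixInt G φ - mixInt H φ = mixInt G ψ - mixInt H ψ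
  unfold mixInt
  congr 1 <;> refine Finset.sum_congr rfl fun x hx => ?_
  · rw [h x (Finset.mem_union_left _ hx)]
  · rw [h x (Finset.mem_union_right _ hx)]

lemma mixDiff_shiftedMonomial {q : ℕ} (G H : Euc q →₀ ℝ) (θ0 : Euc q) (α : Fin q → ℕ) :
    mixDiff G H (shiftedMonomial θ0 α) = momentShift θ0 α G - momentShift θ0 α H := rfl

lemma shiftedMonomial_add_single {q : ℕ} (θ0 : Euc q) (α : Fin q → ℕ) (j : Fin q) (x : Euc q) :
    shiftedMonomial θ0 (α + Pi.single j 1) x = (x j - θ0 j) * shiftedMonomial θ0 α x := by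
  unfold shiftedMonomial
  simp only [Pi.add_apply, pow_add, Finset.prod_mul_distrib]
  rw [mul_comm]
  congr 1
  rw [Finset.prod_eq_single j]
  · simp
  · intro i _ hij
    simp [Pi.single_eq_of_ne hij]
  · simp

/-- Multiplying a test function by an affine function loses one degree of control and a factor
given by the size of the coefficients. -/
lemma abs_map_mul_affine_le {q : ℕ} (θ0 : Euc q) (D : (Euc q → ℝ) →ₗ[ℝ] ℝ) {N m : ℕ} {B : ℝ}
    {φ : Euc q → ℝ}
    (hφ : ∀ β : Fin q → ℕ, (∑ j, β j) + m ≤ N → |D (fun x => shiftedMonomial θ0 β x * φ x)| ≤ B)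
    (u : Fin q → ℝ) (c : ℝ) (β : Fin q → ℕ) (hβ : (∑ j, β j) + (m + 1) ≤ N) :
    |D (fun x => shiftedMonomial θ0 β x * ((∑ j, u j * (x j - θ0 j) + c) * φ x))|
      ≤ ((∑ j, |u j|) + |c|) * B := by
  have e : (fun x => shiftedMonomial θ0 β x * ((∑ j, u j * (x j - θ0 j) + c) * φ x))
      = (∑ j, u j • (fun x => shiftedMonomial θ0 (β + Pi.single j 1) x * φ x))
        + c • (fun x => shiftedMonomial θ0 β x * φ x) := by
    funext x
    simp only [Pi.add_apply, Finset.sum_apply, Pi.smul_apply, smul_eq_mul,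
      shiftedMonomial_add_single]
    rw [add_mul, mul_add, Finset.sum_mul, Finset.mul_sum]
    congr 1
    · exact Finset.sum_congr rfl fun j _ => by ring
    · ring
  rw [e, map_add, map_sum, map_smul, add_mul, Finset.sum_mul]
  refine (abs_add_le _ _).trans (add_le_add ((Finset.abs_sum_le_sum_abs _ _).trans
    (Finset.sum_le_sum fun j _ => ?_)) ?_)
  · rw [map_smul, smul_eq_mul, abs_mul]
    refine mul_le_mul_of_nonneg_left (hφ _ ?_) (abs_nonneg _)
    simp only [Pi.add_apply, Finset.sum_add_distrib, Finset.sum_pi_single', Finset.mem_univ,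
      if_true]
    omega
  · rw [smul_eq_mul, abs_mul]
    exact mul_le_mul_of_nonneg_left (hφ _ (by omega)) (abs_nonneg _)

lemma abs_coord_sub_le {q : ℕ} (x y : Euc q) (j : Fin q) : |x j - y j| ≤ ‖x - y‖ := by
  simpa using PiLp.norm_apply_le (x - y) j

/-- An affine function vanishing at `a` and equal to `1` at `b`, with controlled coefficients. -/
lemma exists_affine_separating {q : ℕ} (θ0 a b : Euc q) {R d : ℝ} (hd : 0 < d)
    (hab : d ≤ ‖a - b‖) (ha : ‖a - θ0‖ ≤ R) (hb : ‖b - θ0‖ ≤ R) :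
    ∃ (u : Fin q → ℝ) (c : ℝ),
      (∑ j, u j * (a j - θ0 j) + c = 0) ∧ (∑ j, u j * (b j - θ0 j) + c = 1) ∧
      (∑ j, |u j|) + |c| ≤ q * (1 + R) / d ∧ (∑ j, |u j|) + |1 - c| ≤ q * (1 + R) / d := by
  have hR : 0 ≤ R := (norm_nonneg _).trans ha
  have hpos : 0 < ‖b - a‖ := by rw [norm_sub_rev]; linarith
  have hab' : d ≤ ‖b - a‖ := by rwa [norm_sub_rev]
  set u : Fin q → ℝ := fun j => (b j - a j) / ‖b - a‖ ^ 2 with hu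
  have hule : ∀ j, |u j| ≤ 1 / d := by
    intro j
    rw [hu]
    simp only [abs_div, abs_pow, abs_norm]
    rw [div_le_div_iff₀ (by positivity) hd]
    have := abs_coord_sub_le b a j
    nlinarith [abs_nonneg (b j - a j)]
  have hsum : ∀ y : Euc q, ‖y - θ0‖ ≤ R →
      (∑ j, |u j|) + |∑ j, u j * (y j - θ0 j)| ≤ q * (1 + R) / d := by
    intro y hy
    have h1 : ∑ j, |u j| ≤ q * (1 / d) := by
      refine (Finset.sum_le_sum fun j _ => hule j).trans ?_
      simp
    have h2 : |∑ j, u j * (y j - θ0 j)| ≤ q * (1 / d * R) := by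
      refine (Finset.abs_sum_le_sum_abs _ _).trans
        ((Finset.sum_le_sum (g := fun _ => 1 / d * R) fun j _ => ?_).trans ?_)
      · rw [abs_mul]
        exact mul_le_mul (hule j) ((abs_coord_sub_le _ _ j).trans hy) (abs_nonneg _)
          (by positivity)
      · simp
    calc _ ≤ q * (1 / d) + q * (1 / d * R) := add_le_add h1 h2
      _ = _ := by ring
  have hdiff : ∑ j, u j * (b j - θ0 j) - ∑ j, u j * (a j - θ0 j) = 1 := by
    rw [← Finset.sum_sub_distrib]
    have : ∀ j, u j * (b j - θ0 j) - u j * (a j - θ0 j) = (b j - a j) ^ 2 / ‖b - a‖ ^ 2 := by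
      intro j
      rw [hu]
      ring
    rw [Finset.sum_congr rfl fun j _ => this j, ← Finset.sum_div, div_eq_one_iff_eq (by positivity),
      EuclideanSpace.real_norm_sq_eq]
    rfl
  refine ⟨u, -∑ j, u j * (a j - θ0 j), by ring, by linarith, ?_, ?_⟩
  · rw [abs_neg]
    exact hsum a ha
  · have : 1 - -∑ j, u j * (a j - θ0 j) = ∑ j, u j * (b j - θ0 j) := by linarith
    rw [this]
    exact hsum b hb

/-- Neville-type step: interpolants on `T \ {a}` and on `T \ {b}` combine to one on `T`. -/
lemma exists_interpolant_step {q : ℕ} (θ0 : Euc q) (D : (Euc q → ℝ) →ₗ[ℝ] ℝ) {N m : ℕ}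
    {R d B : ℝ} (hd : 0 < d) {T : Finset (Euc q)} {f φ ψ : Euc q → ℝ} {a b : Euc q}
    (hab : d ≤ ‖a - b‖) (ha : ‖a - θ0‖ ≤ R) (hb : ‖b - θ0‖ ≤ R) (hB : 0 ≤ B)
    (hφT : ∀ x ∈ T.erase a, φ x = f x) (hψT : ∀ x ∈ T.erase b, ψ x = f x)
    (hφ : ∀ β : Fin q → ℕ, (∑ j, β j) + m ≤ N → |D (fun x => shiftedMonomial θ0 β x * φ x)| ≤ B)
    (hψ : ∀ β : Fin q → ℕ, (∑ j, β j) + m ≤ N → |D (fun x => shiftedMonomial θ0 β x * ψ x)| ≤ B) :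
    ∃ χ : Euc q → ℝ, (∀ x ∈ T, χ x = f x) ∧
      ∀ β : Fin q → ℕ, (∑ j, β j) + (m + 1) ≤ N →
        |D (fun x => shiftedMonomial θ0 β x * χ x)| ≤ 2 * (q + 1) * (1 + R) / d * B := by
  have hR : 0 ≤ R := (norm_nonneg _).trans ha
  obtain ⟨u, c, hua, hub, hc, hc'⟩ := exists_affine_separating θ0 a b hd hab ha hb
  have hne : a ≠ b := by
    rintro rfl
    simp at hab
    linarith
  have hcomp : ∀ x : Euc q, ∑ j, (-u j) * (x j - θ0 j) + (1 - c)
      = 1 - (∑ j, u j * (x j - θ0 j) + c) := by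
    intro x
    simp only [neg_mul, Finset.sum_neg_distrib]
    ring
  refine ⟨fun x => (∑ j, u j * (x j - θ0 j) + c) * φ x
    + (∑ j, (-u j) * (x j - θ0 j) + (1 - c)) * ψ x, ?_, ?_⟩
  · intro x hx
    simp only [hcomp]
    rcases eq_or_ne x a with rfl | hxa
    · rw [hua, hψT x (Finset.mem_erase.2 ⟨hne, hx⟩)]
      ring
    · rcases eq_or_ne x b with rfl | hxb
      · rw [hub, hφT x (Finset.mem_erase.2 ⟨hxa, hx⟩)]
        ring
      · rw [hφT x (Finset.mem_erase.2 ⟨hxa, hx⟩), hψT x (Finset.mem_erase.2 ⟨hxb, hx⟩)]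
        ring
  · intro β hβ
    have h1 := abs_map_mul_affine_le θ0 D hφ u c β hβ
    have h2 := abs_map_mul_affine_le θ0 D hψ (fun j => -u j) (1 - c) β hβ
    simp only [abs_neg] at h2
    have e : (fun x => shiftedMonomial θ0 β x * ((∑ j, u j * (x j - θ0 j) + c) * φ x
          + (∑ j, (-u j) * (x j - θ0 j) + (1 - c)) * ψ x))
        = (fun x => shiftedMonomial θ0 β x * ((∑ j, u j * (x j - θ0 j) + c) * φ x))
          + fun x => shiftedMonomial θ0 β x *
            ((∑ j, (-u j) * (x j - θ0 j) + (1 - c)) * ψ x) := by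
      funext x
      simp only [Pi.add_apply]
      ring
    rw [e, map_add]
    refine (abs_add_le _ _).trans ((add_le_add h1 h2).trans ?_)
    rw [← add_mul]
    refine mul_le_mul_of_nonneg_right ((add_le_add hc hc').trans ?_) hB
    rw [← add_div]
    exact div_le_div_of_nonneg_right (by nlinarith) hd.le

/-- Interpolation of an indicator function on a finite set `T` by a polynomial of degree
`< |T|`, quantified by the pairing with `D`. -/
lemma exists_interpolant_indicator {q : ℕ} (θ0 : Euc q) (D : (Euc q → ℝ) →ₗ[ℝ] ℝ) {N n : ℕ}
    (hn : 1 ≤ n) {R h d K ε : ℝ} (hK : K = 2 * (q + 1) * (1 + R)) (hh : 0 < h) (hhK : h ≤ K)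
    (hd : 0 < d) (hdK : d ≤ K)
    (hD : ∀ β : Fin q → ℕ, (∑ j, β j) + 1 ≤ N → |D (shiftedMonomial θ0 β)| ≤ ε)
    (A : Set (Euc q)) (T : Finset (Euc q)) (hR : ∀ x ∈ T, ‖x - θ0‖ ≤ R)
    (hsep : ∀ a ∈ T, ∀ b ∈ T, a ∈ A → b ∉ A → h ≤ ‖a - b‖)
    (hbig : ∀ U ⊆ T, n < U.card → ∃ a ∈ U, ∃ b ∈ U, d ≤ ‖a - b‖) (hε : 0 ≤ ε) :
    ∃ φ : Euc q → ℝ, (∀ x ∈ T, φ x = A.indicator 1 x) ∧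
      ∀ β : Fin q → ℕ, (∑ j, β j) + T.card ≤ N →
        |D (fun x => shiftedMonomial θ0 β x * φ x)|
          ≤ (K / d) ^ T.card * (K / h) ^ (min T.card n - 1) * ε := by
  have hKd : 1 ≤ K / d := (one_le_div hd).2 hdK
  have hKh : 1 ≤ K / h := (one_le_div hh).2 hhK
  induction T using Finset.strongInduction with
  | H T ih =>
    have step : ∀ a ∈ T, ∀ b ∈ T, ∀ δ : ℝ, 0 < δ → δ ≤ ‖a - b‖ →
        ∃ χ : Euc q → ℝ, (∀ x ∈ T, χ x = A.indicator 1 x) ∧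
          ∀ β : Fin q → ℕ, (∑ j, β j) + T.card ≤ N →
            |D (fun x => shiftedMonomial θ0 β x * χ x)|
              ≤ K / δ * ((K / d) ^ (T.card - 1) * (K / h) ^ (min (T.card - 1) n - 1) * ε) := by
      intro a ha b hb δ hδ hab
      have get : ∀ a ∈ T, ∃ φ : Euc q → ℝ, (∀ x ∈ T.erase a, φ x = A.indicator 1 x) ∧
          ∀ β : Fin q → ℕ, (∑ j, β j) + (T.card - 1) ≤ N →
            |D (fun x => shiftedMonomial θ0 β x * φ x)|
              ≤ (K / d) ^ (T.card - 1) * (K / h) ^ (min (T.card - 1) n - 1) * ε := by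
        intro a ha
        have := ih (T.erase a) (Finset.erase_ssubset ha)
          (fun x hx => hR x (Finset.mem_of_mem_erase hx))
          (fun x hx y hy => hsep x (Finset.mem_of_mem_erase hx) y (Finset.mem_of_mem_erase hy))
          (fun U hU => hbig U (hU.trans (Finset.erase_subset _ _)))
        rwa [Finset.card_erase_of_mem ha] at this
      obtain ⟨φ, hφT, hφ⟩ := get a ha
      obtain ⟨ψ, hψT, hψ⟩ := get b hb
      have hcard : T.card - 1 + 1 = T.card := Nat.succ_pred_eq_of_pos (Finset.card_pos.2 ⟨a, ha⟩)
      have := exists_interpolant_step θ0 D hδ hab (hR a ha) (hR b hb) (by positivity)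
        hφT hψT hφ hψ
      rwa [hcard, ← hK] at this
    by_cases hcard : n < T.card
    · obtain ⟨a, ha, b, hb, hab⟩ := hbig T subset_rfl hcard
      obtain ⟨χ, hχT, hχ⟩ := step a ha b hb d hd hab
      refine ⟨χ, hχT, fun β hβ => (hχ β hβ).trans (le_of_eq ?_)⟩
      have h1 : min (T.card - 1) n = min T.card n := by omega
      obtain ⟨t, ht⟩ : ∃ t, T.card = t + 1 := ⟨T.card - 1, by omega⟩
      rw [h1, ht, Nat.add_sub_cancel, pow_succ]
      ring
    · by_cases hstr : ∃ a ∈ T, ∃ b ∈ T, a ∈ A ∧ b ∉ A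
      · obtain ⟨a, ha, b, hb, haA, hbA⟩ := hstr
        have hab := hsep a ha b hb haA hbA
        have h2 : 1 < T.card := Finset.one_lt_card.2 ⟨a, ha, b, hb, fun e => hbA (e ▸ haA)⟩
        obtain ⟨χ, hχT, hχ⟩ := step a ha b hb h hh hab
        refine ⟨χ, hχT, fun β hβ => (hχ β hβ).trans ?_⟩
        obtain ⟨t, ht⟩ : ∃ t, T.card = t + 2 := ⟨T.card - 2, by omega⟩
        have h3 : min (T.card - 1) n - 1 = t := by omega
        have h4 : min T.card n - 1 = t + 1 := by omega
        rw [h3, h4]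
        calc K / h * ((K / d) ^ (T.card - 1) * (K / h) ^ t * ε)
            = (K / d) ^ (T.card - 1) * (K / h) ^ (t + 1) * ε := by ring
          _ ≤ _ := by
            gcongr
            omega
      · push Not at hstr
        have hone : 1 ≤ (K / d) ^ T.card * (K / h) ^ (min T.card n - 1) :=
          one_le_mul_of_one_le_of_one_le (one_le_pow₀ hKd) (one_le_pow₀ hKh)
        by_cases hA : ∃ a ∈ T, a ∈ A
        · obtain ⟨a, ha, haA⟩ := hA
          refine ⟨1, fun x hx => by simp [hstr a ha x hx haA], fun β hβ => ?_⟩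
          have : 1 ≤ T.card := Finset.card_pos.2 ⟨a, ha⟩
          simp only [Pi.one_apply, mul_one]
          exact (hD β (by omega)).trans (le_mul_of_one_le_left hε hone)
        · push Not at hA
          refine ⟨0, fun x hx => by simp [hA x hx], fun β _ => ?_⟩
          simp only [Pi.zero_apply, mul_zero]
          have : (fun _ : Euc q => (0 : ℝ)) = 0 := rfl
          rw [this, map_zero, abs_zero]
          positivity

/-- The scales `h` at which some subset of `S` containing `x` but not `y` is `h`-separated from
its complement in `S`. -/
def separationScales {X : Type*} [MetricSpace X] (S : Finset X) (x y : X) : Set ℝ :=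
  {h | ∃ A : Set X, x ∈ A ∧ y ∉ A ∧ ∀ a ∈ S, ∀ b ∈ S, a ∈ A → b ∉ A → h ≤ dist a b}

/-- The single-linkage ultrametric of a finite set `S`. -/
def linkage {X : Type*} [MetricSpace X] (S : Finset X) (x y : X) : ℝ :=
  sSup (separationScales S x y)

section Linkage

variable {X : Type*} [MetricSpace X] {S : Finset X} {x y z : X}

lemma linkage_le_dist (hx : x ∈ S) (hy : y ∈ S) : linkage S x y ≤ dist x y :=
  Real.sSup_le (fun _ ⟨_, hxA, hyA, hA⟩ => hA x hx y hy hxA hyA) dist_nonneg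

lemma le_linkage (hx : x ∈ S) (hy : y ∈ S) {h : ℝ} (hh : h ∈ separationScales S x y) :
    h ≤ linkage S x y :=
  le_csSup ⟨dist x y, fun _ ⟨_, hxA, hyA, hA⟩ => hA x hx y hy hxA hyA⟩ hh

lemma linkage_nonneg (hx : x ∈ S) (hy : y ∈ S) : 0 ≤ linkage S x y := by
  rcases (separationScales S x y).eq_empty_or_nonempty with he | ⟨h, A, hxA, hyA, hA⟩
  · rw [linkage, he, Real.sSup_empty]
  · exact le_linkage hx hy ⟨A, hxA, hyA, fun _ _ _ _ _ _ => dist_nonneg⟩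

lemma linkage_self : linkage S x x = 0 := by
  have : separationScales S x x = ∅ := by
    ext h
    simp only [separationScales, Set.mem_ofPred_eq, Set.mem_empty_iff_false, iff_false]
    rintro ⟨A, h1, h2, -⟩
    exact h2 h1
  rw [linkage, this, Real.sSup_empty]

lemma linkage_comm : linkage S x y = linkage S y x := by
  have key : ∀ x y : X, separationScales S x y ⊆ separationScales S y x := by
    rintro x y h ⟨A, hx, hy, hA⟩
    refine ⟨Aᶜ, hy, fun h => h hx, fun a ha b hb haA hbA => ?_⟩
    rw [dist_comm]
    exact hA b hb a ha (not_not.1 hbA) haA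
  rw [linkage, linkage, (key x y).antisymm (key y x)]

lemma linkage_le_max (hx : x ∈ S) (hy : y ∈ S) (hz : z ∈ S) :
    linkage S x z ≤ max (linkage S x y) (linkage S y z) := by
  refine Real.sSup_le ?_ (le_max_of_le_left (linkage_nonneg hx hy))
  rintro h ⟨A, hxA, hzA, hA⟩
  by_cases hyA : y ∈ A
  · exact le_max_of_le_right (le_linkage hy hz ⟨A, hyA, hzA, hA⟩)
  · exact le_max_of_le_left (le_linkage hx hy ⟨A, hxA, hyA, hA⟩)

lemma dist_le_card_mul_linkage (hx : x ∈ S) (hy : y ∈ S) :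
    dist x y ≤ S.card * linkage S x y := by
  have hS : 0 < (S.card : ℝ) := by exact_mod_cast Finset.card_pos.2 ⟨x, hx⟩
  rcases eq_or_ne x y with rfl | hxy
  · simp [linkage_self]
  have hpos : 0 < dist x y := dist_pos.2 hxy
  set g := dist x y / S.card with hg
  have hgpos : 0 < g := by positivity
  have hgS : S.card * g = dist x y := by
    rw [hg]
    field_simp
  suffices g ≤ linkage S x y by
    rw [← hgS]
    exact mul_le_mul_of_nonneg_left this hS.le
  obtain ⟨j, hj, hgap⟩ : ∃ j < S.card, ∀ z ∈ S, dist x z ≤ j * g ∨ (j + 1) * g ≤ dist x z := by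
    by_contra! hcon
    classical
    have : Nonempty X := ⟨x⟩
    choose! w hwS hw1 hw2 using hcon
    have hinj : Set.InjOn w (Finset.range S.card : Set ℕ) := by
      have lt_of : ∀ i < S.card, ∀ j < S.card, w i = w j → i ≤ j := by
        intro i hi j hj hij
        have h1 := hw1 i hi
        rw [hij] at h1
        have h2 := lt_of_mul_lt_mul_right (h1.trans (hw2 j hj)) hgpos.le
        exact Nat.lt_succ_iff.1 (by exact_mod_cast h2)
      intro i hi j hj hij
      simp only [Finset.coe_range, Set.mem_Iio] at hi hj
      exact le_antisymm (lt_of i hi j hj hij) (lt_of j hj i hi hij.symm)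
    have hmaps : Set.MapsTo w (Finset.range S.card : Set ℕ) (S.erase x : Set X) := by
      intro i hi
      simp only [Finset.coe_range, Set.mem_Iio] at hi
      refine Finset.mem_coe.2 (Finset.mem_erase.2 ⟨fun e => ?_, hwS i hi⟩)
      have := hw1 i hi
      rw [e, dist_self] at this
      have h0 : 0 ≤ (i : ℝ) * g := by positivity
      linarith
    have := Finset.card_le_card_of_injOn w hmaps hinj
    rw [Finset.card_range, Finset.card_erase_of_mem hx] at this
    have := Finset.card_pos.2 ⟨x, hx⟩
    omega
  refine le_linkage hx hy ⟨{z | dist x z ≤ j * g}, ?_, ?_, ?_⟩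
  · simp only [Set.mem_ofPred_eq, dist_self]
    positivity
  · simp only [Set.mem_ofPred_eq, not_le]
    rw [← hgS]
    exact mul_lt_mul_of_pos_right (by exact_mod_cast hj) hgpos
  · intro a _ b hb ha hb'
    simp only [Set.mem_ofPred_eq] at ha hb'
    have h1 := (hgap b hb).resolve_left hb'
    have h2 := dist_triangle x a b
    linarith

/-- Linkage balls are separated from their complement. -/
lemma linkage_ball_separated {h : ℝ} (hx : x ∈ S) {a b : X} (ha : a ∈ S) (hb : b ∈ S)
    (hxa : linkage S x a < h) (hxb : h ≤ linkage S x b) : h ≤ linkage S a b := by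
  rcases le_max_iff.1 (linkage_le_max hx ha hb) with h1 | h1
  · linarith
  · linarith

end Linkage

lemma isCoupling_prod {q : ℕ} {G H : Euc q →₀ ℝ} (hG0 : ∀ x ∈ G.support, 0 < G x)
    (hH0 : ∀ x ∈ H.support, 0 < H x) (hG : ∑ x ∈ G.support, G x = 1)
    (hH : ∑ x ∈ H.support, H x = 1) : IsCoupling G H fun p => G p.1 * H p.2 := by
  have nonneg : ∀ F : Euc q →₀ ℝ, (∀ x ∈ F.support, 0 < F x) → ∀ x, 0 ≤ F x := by
    intro F hF x
    by_cases hx : x ∈ F.support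
    · exact (hF x hx).le
    · rw [Finsupp.notMem_support_iff.1 hx]
  refine ⟨fun p => mul_nonneg (nonneg G hG0 _) (nonneg H hH0 _), fun x _ => ?_, fun y _ => ?_⟩
  · simp only
    rw [← Finset.mul_sum, hH, mul_one]
  · simp only
    rw [← Finset.sum_mul, hG, one_mul]

/-- The optimal transport problem between finitely supported measures has a solution. -/
lemma exists_optimal_coupling {q : ℕ} {G H : Euc q →₀ ℝ} (hne : ∃ π, IsCoupling G H π)
    (c : Euc q × Euc q → ℝ) : ∃ π, IsCoupling G H π ∧ ∀ π', IsCoupling G H π' →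
      ∑ p ∈ G.support ×ˢ H.support, π p * c p ≤ ∑ p ∈ G.support ×ˢ H.support, π' p * c p := by
  classical
  set E := G.support ×ˢ H.support with hE
  let cut : (Euc q × Euc q → ℝ) → Euc q × Euc q → ℝ := fun π p => if p ∈ E then π p else 0
  have cut_apply : ∀ π, ∀ p ∈ E, cut π p = π p := fun π p hp => if_pos hp
  have hcut : ∀ π, IsCoupling G H π → IsCoupling G H (cut π) := by
    rintro π ⟨h0, h1, h2⟩
    refine ⟨fun p => ?_, fun x hx => ?_, fun y hy => ?_⟩
    · by_cases hp : p ∈ E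
      · rw [cut_apply π p hp]
        exact h0 p
      · exact (if_neg hp).ge
    · rw [← h1 x hx]
      exact Finset.sum_congr rfl fun y hy => cut_apply π _ (Finset.mk_mem_product hx hy)
    · rw [← h2 y hy]
      exact Finset.sum_congr rfl fun x hx => cut_apply π _ (Finset.mk_mem_product hx hy)
  let P : Set (Euc q × Euc q → ℝ) := {π | IsCoupling G H π ∧ ∀ p, p ∉ E → π p = 0}
  have hPclosed : IsClosed P := by
    have e : P = (⋂ p, {π | 0 ≤ π p}) ∩ (⋂ x ∈ G.support, {π | ∑ y ∈ H.support, π (x, y) = G x})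
        ∩ (⋂ y ∈ H.support, {π | ∑ x ∈ G.support, π (x, y) = H y})
        ∩ ⋂ p, ⋂ (_ : p ∉ E), {π | π p = 0} := by
      ext π
      simp only [P, IsCoupling, Set.mem_ofPred_eq, Set.mem_inter_iff, Set.mem_iInter, and_assoc]
    rw [e]
    refine ((IsClosed.inter ?_ ?_).inter ?_).inter ?_
    · exact isClosed_iInter fun p => isClosed_le continuous_const (continuous_apply p)
    · exact isClosed_biInter fun x _ => isClosed_eq (by fun_prop) continuous_const
    · exact isClosed_biInter fun x _ => isClosed_eq (by fun_prop) continuous_const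
    · exact isClosed_iInter fun p => isClosed_iInter fun _ =>
        isClosed_eq (continuous_apply p) continuous_const
  have hPcompact : IsCompact P := by
    refine (isCompact_univ_pi fun p : Euc q × Euc q =>
      isCompact_Icc (a := (0 : ℝ)) (b := |G p.1|)).of_isClosed_subset hPclosed ?_
    rintro π ⟨⟨h0, h1, -⟩, h3⟩ p -
    refine ⟨h0 p, ?_⟩
    by_cases hp : p ∈ E
    · obtain ⟨hx, hy⟩ := Finset.mem_product.1 hp
      refine le_trans ?_ (le_abs_self _)
      rw [← h1 p.1 hx]
      exact Finset.single_le_sum (f := fun y => π (p.1, y)) (fun y _ => h0 _) hy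
    · rw [h3 p hp]
      exact abs_nonneg _
  obtain ⟨π₀, hπ₀⟩ := hne
  obtain ⟨π, hπP, hπmin⟩ := hPcompact.exists_isMinOn
    ⟨cut π₀, hcut π₀ hπ₀, fun p hp => if_neg hp⟩
    (f := fun π : Euc q × Euc q → ℝ => ∑ p ∈ E, π p * c p)
    (by fun_prop)
  refine ⟨π, hπP.1, fun π' hπ' => ?_⟩
  have h := hπmin (show cut π' ∈ P from ⟨hcut π' hπ', fun p hp => if_neg hp⟩)
  simp only [Set.mem_ofPred_eq] at h
  refine h.trans (le_of_eq (Finset.sum_congr rfl fun p hp => ?_))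
  rw [cut_apply π' p hp]

/-- Optimality forbids improving a coupling by swapping the targets of two transported atoms. -/
lemma optimal_coupling_swap {q : ℕ} {G H : Euc q →₀ ℝ} {c : Euc q × Euc q → ℝ}
    {π : Euc q × Euc q → ℝ} (hπ : IsCoupling G H π)
    (hopt : ∀ π', IsCoupling G H π' →
      ∑ p ∈ G.support ×ˢ H.support, π p * c p ≤ ∑ p ∈ G.support ×ˢ H.support, π' p * c p)
    {x x' y y' : Euc q} (hx : x ∈ G.support) (hx' : x' ∈ G.support) (hy : y ∈ H.support)
    (hy' : y' ∈ H.support) (hxx : x ≠ x') (hyy : y ≠ y') (h : 0 < π (x, y))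
    (h' : 0 < π (x', y')) : c (x, y) + c (x', y') ≤ c (x, y') + c (x', y) := by
  classical
  obtain ⟨h0, h1, h2⟩ := hπ
  set δ := min (π (x, y)) (π (x', y')) with hδ
  have hδpos : 0 < δ := lt_min h h'
  let s : Euc q → ℝ := fun z => if z = x then 1 else if z = x' then -1 else 0
  let t : Euc q → ℝ := fun z => if z = y then 1 else if z = y' then -1 else 0
  have sumsingle : ∀ (F : Finset (Euc q)) (a b : Euc q), a ∈ F → b ∈ F → a ≠ b →
      ∀ g : Euc q → ℝ, ∑ z ∈ F, (if z = a then 1 else if z = b then -1 else 0) * g z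
        = g a - g b := by
    intro F a b ha hb hab g
    have : ∀ z, (if z = a then (1 : ℝ) else if z = b then -1 else 0) * g z
        = (if z = a then g z else 0) - (if z = b then g z else 0) := by
      intro z
      by_cases hza : z = a
      · subst hza
        simp [hab]
      · by_cases hzb : z = b
        · subst hzb
          simp [hza]
        · simp [hza, hzb]
    rw [Finset.sum_congr rfl fun z _ => this z, Finset.sum_sub_distrib]
    simp [ha, hb]
  have hs : ∀ g : Euc q → ℝ, ∑ z ∈ G.support, s z * g z = g x - g x' :=
    sumsingle G.support x x' hx hx' hxx
  have ht : ∀ g : Euc q → ℝ, ∑ z ∈ H.support, t z * g z = g y - g y' :=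
    sumsingle H.support y y' hy hy' hyy
  have hcoup : IsCoupling G H fun p => π p - δ * (s p.1 * t p.2) := by
    refine ⟨fun p => ?_, fun a ha => ?_, fun b hb => ?_⟩
    · obtain ⟨a, b⟩ := p
      have hab := h0 (a, b)
      simp only [s, t]
      split_ifs with e1 e2 e3 e4 e5 e6 <;> try nlinarith
      · subst e1 e2
        have := min_le_left (π (a, b)) (π (x', y'))
        linarith
      · subst e4 e6
        have := min_le_right (π (x, y)) (π (a, b))
        linarith
    · simp only
      rw [Finset.sum_sub_distrib, h1 a ha, ← Finset.mul_sum, ← Finset.mul_sum]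
      have := ht fun _ => 1
      simp only [mul_one, sub_self] at this
      rw [this]
      ring
    · simp only
      rw [Finset.sum_sub_distrib, h2 b hb, ← Finset.mul_sum, ← Finset.sum_mul]
      have := hs fun _ => 1
      simp only [mul_one, sub_self] at this
      rw [this]
      ring
  have hcost := hopt _ hcoup
  have e : ∑ p ∈ G.support ×ˢ H.support, (π p - δ * (s p.1 * t p.2)) * c p
      = ∑ p ∈ G.support ×ˢ H.support, π p * c p
        - δ * ((c (x, y) - c (x, y')) - (c (x', y) - c (x', y'))) := by
    simp only [sub_mul]
    rw [Finset.sum_sub_distrib]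
    congr 1
    rw [Finset.sum_product]
    have : ∀ a ∈ G.support, ∑ b ∈ H.support, δ * (s a * t b) * c (a, b)
        = δ * (s a * (c (a, y) - c (a, y'))) := by
      intro a _
      rw [← ht fun b => c (a, b), Finset.mul_sum, Finset.mul_sum]
      exact Finset.sum_congr rfl fun b _ => by ring
    rw [Finset.sum_congr rfl this, ← Finset.mul_sum, hs fun a => c (a, y) - c (a, y')]
  rw [e] at hcost
  by_contra! hlt
  have : 0 < δ * ((c (x, y) - c (x, y')) - (c (x', y) - c (x', y'))) :=
    mul_pos hδpos (by linarith)
  linarith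

/-- The mass crossing the boundary of `A` outwards, minus the mass crossing it inwards, is
`G(A) - H(A)`. -/
lemma mixDiff_indicator_eq {q : ℕ} {G H : Euc q →₀ ℝ} {π : Euc q × Euc q → ℝ}
    (hπ : IsCoupling G H π) (A : Set (Euc q)) :
    mixDiff G H (A.indicator 1) = ∑ p ∈ G.support ×ˢ H.support,
      π p * (A.indicator 1 p.1 - A.indicator 1 p.2) := by
  obtain ⟨-, h1, h2⟩ := hπ
  change mixInt G _ - mixInt H _ = _
  simp only [mul_sub]
  rw [Finset.sum_sub_distrib, Finset.sum_product, Finset.sum_product_right]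
  unfold mixInt
  congr 1 <;> refine Finset.sum_congr rfl fun x hx => ?_
  · simp only
    rw [← Finset.sum_mul, h1 x hx]
  · simp only
    rw [← Finset.sum_mul, h2 x hx]

lemma Wpow_le_of_coupling {q : ℕ} {G H : Euc q →₀ ℝ} {π : Euc q × Euc q → ℝ} (ℓ : ℝ)
    (hπ : IsCoupling G H π) :
    Wpow ℓ G H ≤ ∑ p ∈ G.support ×ˢ H.support, π p * ‖p.1 - p.2‖ ^ ℓ := by
  refine csInf_le ⟨0, ?_⟩ ⟨π, hπ, rfl⟩
  rintro _ ⟨π', hπ', rfl⟩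
  exact Finset.sum_nonneg fun p _ => mul_nonneg (hπ'.1 p) (Real.rpow_nonneg (norm_nonneg _) _)

/-- The transport cost is controlled by the mass imbalances of separated clusters. -/
lemma Wpow_le_of_cluster_imbalance {q : ℕ} {G H : Euc q →₀ ℝ} (hne : ∃ π, IsCoupling G H π)
    {ℓ : ℕ} (hℓ : ℓ ≠ 0) {M : ℝ} (hM : 0 ≤ M) {N : ℕ}
    (hN : (G.support ∪ H.support).card ≤ N)
    (hA : ∀ (A : Set (Euc q)) (h : ℝ), 0 < h →
      (∃ x ∈ G.support ∪ H.support, ∃ y ∈ G.support ∪ H.support, x ∈ A ∧ y ∉ A) →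
      (∀ a ∈ G.support ∪ H.support, ∀ b ∈ G.support ∪ H.support, a ∈ A → b ∉ A → h ≤ ‖a - b‖) →
      |mixDiff G H (A.indicator 1)| * h ^ ℓ ≤ M) :
    Wpow (ℓ : ℝ) G H ≤ (N : ℝ) ^ 2 * ((N : ℝ) ^ ℓ * M) := by
  classical
  set S := G.support ∪ H.support with hS
  have hGS : ∀ x ∈ G.support, x ∈ S := fun x hx => Finset.mem_union_left _ hx
  have hHS : ∀ x ∈ H.support, x ∈ S := fun x hx => Finset.mem_union_right _ hx
  obtain ⟨π, hπ, hopt⟩ := exists_optimal_coupling hne fun p => linkage S p.1 p.2 ^ ℓ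
  have hcell : ∀ p ∈ G.support ×ˢ H.support, π p * linkage S p.1 p.2 ^ ℓ ≤ M := by
    rintro ⟨x, y⟩ hp
    obtain ⟨hx, hy⟩ := Finset.mem_product.1 hp
    simp only at hx hy ⊢
    rcases (hπ.1 (x, y)).eq_or_lt with h0 | hpos
    · rw [← h0, zero_mul]
      exact hM
    rcases (linkage_nonneg (hGS x hx) (hHS y hy)).eq_or_lt with h0 | hh
    · rw [← h0, zero_pow hℓ, mul_zero]
      exact hM
    set h := linkage S x y with hdef
    let C : Set (Euc q) := {z | linkage S x z < h}
    have hxC : x ∈ C := by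
      change linkage S x x < h
      rwa [linkage_self]
    have hyC : y ∉ C := fun hlt => lt_irrefl h hlt
    have hsep : ∀ a ∈ S, ∀ b ∈ S, a ∈ C → b ∉ C → h ≤ linkage S a b := fun a ha b hb haC hbC =>
      linkage_ball_separated (hGS x hx) ha hb haC (not_lt.1 hbC)
    have hin : ∀ x' ∈ G.support, ∀ y' ∈ H.support, x' ∉ C → y' ∈ C → π (x', y') = 0 := by
      intro x' hx' y' hy' hx'C hy'C
      by_contra hne0
      have hpos' : 0 < π (x', y') := lt_of_le_of_ne (hπ.1 _) (Ne.symm hne0)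
      have hswap := optimal_coupling_swap hπ hopt hx hx' hy hy'
        (fun e => hx'C (e ▸ hxC)) (fun e => hyC (e ▸ hy'C)) hpos hpos'
      simp only at hswap
      have h1 : linkage S x y' ^ ℓ < h ^ ℓ :=
        pow_lt_pow_left₀ hy'C (linkage_nonneg (hGS x hx) (hHS y' hy')) hℓ
      have h2 : h ≤ linkage S x' y' := by
        rw [linkage_comm]
        exact hsep y' (hHS y' hy') x' (hGS x' hx') hy'C hx'C
      have h3 : linkage S x' y ≤ linkage S x' y' := by
        refine (linkage_le_max (hGS x' hx') (hHS y' hy') (hHS y hy)).trans (max_le le_rfl ?_)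
        refine (linkage_le_max (hHS y' hy') (hGS x hx) (hHS y hy)).trans (max_le ?_ h2)
        rw [linkage_comm]
        exact (le_of_lt hy'C).trans h2
      have h4 : linkage S x' y ^ ℓ ≤ linkage S x' y' ^ ℓ :=
        pow_le_pow_left₀ (linkage_nonneg (hGS x' hx') (hHS y hy)) h3 ℓ
      linarith
    have hflow : π (x, y) ≤ mixDiff G H (C.indicator 1) := by
      rw [mixDiff_indicator_eq hπ]
      have hterm : ∀ p ∈ G.support ×ˢ H.support,
          0 ≤ π p * (C.indicator 1 p.1 - C.indicator 1 p.2) := by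
        rintro ⟨a, b⟩ hab
        obtain ⟨ha, hb⟩ := Finset.mem_product.1 hab
        simp only at ha hb ⊢
        have h0 := hπ.1 (a, b)
        by_cases haC : a ∈ C <;> by_cases hbC : b ∈ C <;> simp [haC, hbC, h0]
        exact (hin a ha b hb haC hbC).le
      have := Finset.single_le_sum hterm hp
      simpa [hxC, hyC] using this
    have := hA C h hh ⟨x, hGS x hx, y, hHS y hy, hxC, hyC⟩ fun a ha b hb haC hbC => by
      rw [← dist_eq_norm]
      exact (hsep a ha b hb haC hbC).trans (linkage_le_dist ha hb)
    exact (mul_le_mul_of_nonneg_right (hflow.trans (le_abs_self _)) (by positivity)).trans this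
  have hNS : (S.card : ℝ) ≤ N := by exact_mod_cast hN
  have hcost : ∀ p ∈ G.support ×ˢ H.support, π p * ‖p.1 - p.2‖ ^ (ℓ : ℝ) ≤ (N : ℝ) ^ ℓ * M := by
    rintro ⟨x, y⟩ hp
    obtain ⟨hx, hy⟩ := Finset.mem_product.1 hp
    have hl := linkage_nonneg (hGS x hx) (hHS y hy)
    simp only at hx hy ⊢
    rw [Real.rpow_natCast, ← dist_eq_norm]
    calc π (x, y) * dist x y ^ ℓ ≤ π (x, y) * (N * linkage S x y) ^ ℓ := by
          refine mul_le_mul_of_nonneg_left (pow_le_pow_left₀ dist_nonneg ?_ ℓ) (hπ.1 _)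
          exact (dist_le_card_mul_linkage (hGS x hx) (hHS y hy)).trans
            (mul_le_mul_of_nonneg_right hNS hl)
      _ = (N : ℝ) ^ ℓ * (π (x, y) * linkage S x y ^ ℓ) := by ring
      _ ≤ _ := mul_le_mul_of_nonneg_left (hcell (x, y) hp) (by positivity)
  refine (Wpow_le_of_coupling _ hπ).trans ((Finset.sum_le_card_nsmul _ _ _ hcost).trans ?_)
  rw [nsmul_eq_mul, Finset.card_product]
  refine mul_le_mul_of_nonneg_right ?_ (by positivity)
  have h1 : (G.support.card : ℝ) ≤ N := by
    exact_mod_cast (Finset.card_le_card Finset.subset_union_left).trans hN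
  have h2 : (H.support.card : ℝ) ≤ N := by
    exact_mod_cast (Finset.card_le_card Finset.subset_union_right).trans hN
  push_cast
  rw [sq]
  exact mul_le_mul h1 h2 (by positivity) (by positivity)

lemma MixG.exists_isCoupling {q k k' : ℕ} {Θ : Set (Euc q)} {G H : Euc q →₀ ℝ}
    (hG : MixG Θ k G) (hH : MixG Θ k' H) : ∃ π, IsCoupling G H π :=
  ⟨_, isCoupling_prod hG.1.1 hH.1.1 hG.1.2.1 hH.1.2.1⟩

/-- Comparison of the transport cost with the moments up to degree `2k - 1`. Here `n` bounds the
number of atoms in any cluster of diameter smaller than `d`. -/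
lemma Wpow_le_of_moments {q k n : ℕ} (hn : 2 ≤ n) (hk : 1 ≤ k) (θ0 : Euc q) {R d K ε : ℝ}
    (hR0 : 0 ≤ R) (hK : K = 2 * (q + 1) * (1 + R)) (hd : 0 < d) (hdK : d ≤ K) (hε : 0 ≤ ε)
    {Θ : Set (Euc q)} (hΘ : ∀ x ∈ Θ, ‖x - θ0‖ ≤ R) {G H : Euc q →₀ ℝ}
    (hG : MixG Θ k G) (hH : MixG Θ k H)
    (hbig : ∀ U ⊆ G.support ∪ H.support, n < U.card → ∃ a ∈ U, ∃ b ∈ U, d ≤ ‖a - b‖)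
    (hmom : ∀ β : Fin q → ℕ, (∑ j, β j) ≤ 2 * k - 1 →
      |momentShift θ0 β G - momentShift θ0 β H| ≤ ε) :
    Wpow ((n - 1 : ℕ) : ℝ) G H ≤ ((2 * k : ℕ) : ℝ) ^ 2 *
      (((2 * k : ℕ) : ℝ) ^ (n - 1) * ((K / d) ^ (2 * k) * K ^ (n - 1) * ε)) := by
  classical
  have hSR : ∀ x ∈ G.support ∪ H.support, ‖x - θ0‖ ≤ R := by
    intro x hx
    rcases Finset.mem_union.1 hx with hx | hx
    · exact hΘ x (hG.1.2.2 hx)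
    · exact hΘ x (hH.1.2.2 hx)
  have hcard : (G.support ∪ H.support).card ≤ 2 * k := by
    have := Finset.card_union_le G.support H.support
    have := hG.2
    have := hH.2
    omega
  have hKpos : 0 < K := hd.trans_le hdK
  have hKd : 1 ≤ K / d := (one_le_div hd).2 hdK
  refine Wpow_le_of_cluster_imbalance (hG.exists_isCoupling hH) (by omega) (by positivity) hcard ?_
  rintro A h hh ⟨x, hx, y, hy, hxA, hyA⟩ hsep
  have hhK : h ≤ K := by
    have h1 : ‖x - y‖ ≤ ‖x - θ0‖ + ‖y - θ0‖ := by
      rw [← dist_eq_norm, ← dist_eq_norm, ← dist_eq_norm]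
      exact dist_triangle_right _ _ _
    have h2 := hsep x hx y hy hxA hyA
    have h3 := hSR x hx
    have h4 := hSR y hy
    have hq : (0 : ℝ) ≤ q := Nat.cast_nonneg q
    have h5 : 0 ≤ q * (1 + R) := by positivity
    rw [hK]
    linarith
  have hKh : 1 ≤ K / h := (one_le_div hh).2 hhK
  obtain ⟨φ, hφ, hφD⟩ := exists_interpolant_indicator (N := 2 * k) θ0 (mixDiff G H)
    (by omega : 1 ≤ n) hK hh hhK hd hdK
    (fun β hβ => by
      rw [mixDiff_shiftedMonomial]
      exact hmom β (by omega)) A (G.support ∪ H.support) hSR hsep hbig hε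
  have hbound := hφD 0 (by simpa using hcard)
  have hone : (fun x => shiftedMonomial θ0 0 x * φ x) = φ := by
    funext x
    simp [shiftedMonomial]
  rw [hone, mixDiff_congr G H hφ] at hbound
  calc |mixDiff G H (A.indicator 1)| * h ^ (n - 1)
      ≤ ((K / d) ^ (2 * k) * (K / h) ^ (n - 1) * ε) * h ^ (n - 1) := by
        refine mul_le_mul_of_nonneg_right (hbound.trans ?_) (by positivity)
        refine mul_le_mul_of_nonneg_right (mul_le_mul ?_ ?_ (by positivity) (by positivity)) hε
        · exact pow_le_pow_right₀ hKd hcard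
        · exact pow_le_pow_right₀ hKh (by omega)
    _ = (K / d) ^ (2 * k) * K ^ (n - 1) * ε := by
        rw [div_pow K h]
        field_simp

/-- Any bound of the transport cost by the largest moment difference is an inverse bound at
some multi-index. -/
lemma exists_moment_ge {q m : ℕ} (θ0 : Euc q) (G H : Euc q →₀ ℝ) {C W : ℝ} (hC : 0 < C)
    (hW : ∀ ε : ℝ, 0 ≤ ε → (∀ β : Fin q → ℕ, (∑ j, β j) ≤ m →
      |momentShift θ0 β G - momentShift θ0 β H| ≤ ε) → W ≤ C * ε) :
    ∃ α : Fin q → ℕ, (∑ j, α j) ≤ m ∧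
      C⁻¹ * W ≤ |momentShift θ0 α G - momentShift θ0 α H| := by
  have mem : ∀ β : Fin q → ℕ, β ∈ multiIdx q m ↔ (∑ j, β j) ≤ m := by
    intro β
    simp only [multiIdx, Finset.mem_filter, Fintype.mem_piFinset, Finset.mem_range,
      and_iff_right_iff_imp]
    intro h j
    have := Finset.single_le_sum (f := β) (fun _ _ => Nat.zero_le _) (Finset.mem_univ j)
    omega
  obtain ⟨α, hα, hmax⟩ := (multiIdx q m).exists_max_image
    (fun β => |momentShift θ0 β G - momentShift θ0 β H|) ⟨0, (mem 0).2 (by simp)⟩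
  refine ⟨α, (mem α).1 hα, ?_⟩
  rw [inv_mul_le_iff₀ hC]
  exact hW _ (abs_nonneg _) fun β hβ => hmax β ((mem β).2 hβ)

/-- A measure close to `G0` in transport distance has an atom near every atom of `G0`. -/
lemma exists_atom_near {q : ℕ} {G G0 : Euc q →₀ ℝ} (hne : ∃ π, IsCoupling G G0 π) {r s : ℝ}
    {a : Euc q} (ha : a ∈ G0.support) (hW : Wpow 1 G G0 ≤ r) (hr : r < G0 a * s) :
    ∃ x ∈ G.support, ‖x - a‖ < s := by
  by_contra! hfar
  refine absurd (hr.trans_le ?_) (not_lt.2 hW)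
  obtain ⟨π₀, hπ₀⟩ := hne
  refine le_csInf ⟨_, π₀, hπ₀, rfl⟩ ?_
  rintro _ ⟨π, hπ, rfl⟩
  have hnn : ∀ p : Euc q × Euc q, 0 ≤ π p * ‖p.1 - p.2‖ := fun p =>
    mul_nonneg (hπ.1 p) (norm_nonneg _)
  simp only [Real.rpow_one]
  rw [Finset.sum_product_right]
  calc G0 a * s = ∑ x ∈ G.support, π (x, a) * s := by rw [← Finset.sum_mul, hπ.2.2 a ha]
    _ ≤ ∑ x ∈ G.support, π (x, a) * ‖x - a‖ :=
        Finset.sum_le_sum fun x hx => mul_le_mul_of_nonneg_left (hfar x hx) (hπ.1 _)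
    _ ≤ _ := Finset.single_le_sum
        (f := fun y => ∑ x ∈ G.support, π (x, y) * ‖x - y‖)
        (fun y _ => Finset.sum_nonneg fun x _ => hnn (x, y)) ha

/-- If `F` meets the `δ/4`-ball around every point of the `δ`-separated set `A`, then a set of
diameter less than `δ/2` misses at least `|A| - 1` points of `F`. -/
lemma card_inter_add_card_le {q : ℕ} [DecidableEq (Euc q)] {A F U : Finset (Euc q)} {δ : ℝ}
    (hA : ∀ a ∈ A, ∀ b ∈ A, a ≠ b → δ ≤ ‖a - b‖)
    (hF : ∀ a ∈ A, ∃ x ∈ F, ‖x - a‖ < δ / 4) (hU : ∀ x ∈ U, ∀ y ∈ U, ‖x - y‖ < δ / 2) :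
    (U ∩ F).card + A.card ≤ F.card + 1 := by
  choose! g hgF hg using hF
  have close : ∀ a ∈ A, ∀ b ∈ A, ‖g a - g b‖ < δ / 2 → a = b := by
    intro a ha b hb hab
    by_contra hne
    have h1 := hA a ha b hb hne
    have h2 := hg a ha
    have h3 := hg b hb
    rw [← dist_eq_norm] at h1 h2 h3 hab
    have h4 := dist_triangle4 a (g a) (g b) b
    rw [dist_comm a (g a)] at h4
    linarith
  have hin : (A.filter fun a => g a ∈ U).card ≤ 1 := by
    refine Finset.card_le_one.2 fun a ha b hb => ?_
    rw [Finset.mem_filter] at ha hb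
    exact close a ha.1 b hb.1 (hU _ ha.2 _ hb.2)
  have hout : (A.filter fun a => g a ∉ U).card ≤ (F \ U).card := by
    refine Finset.card_le_card_of_injOn g (fun a ha => ?_) fun a ha b hb hab => ?_
    · have ha := Finset.mem_filter.1 (Finset.mem_coe.1 ha)
      exact Finset.mem_coe.2 (Finset.mem_sdiff.2 ⟨hgF a ha.1, ha.2⟩)
    · have ha := Finset.mem_filter.1 (Finset.mem_coe.1 ha)
      have hb := Finset.mem_filter.1 (Finset.mem_coe.1 hb)
      refine close a ha.1 b hb.1 ?_
      rw [hab, sub_self, norm_zero]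
      have := (norm_nonneg _).trans_lt (hg a ha.1)
      linarith
  have hsplit := Finset.card_filter_add_card_filter_not (s := A) (fun a => g a ∈ U)
  have hF' := Finset.card_inter_add_card_sdiff F U
  rw [Finset.inter_comm] at hF'
  omega

lemma exists_separation {q : ℕ} (A : Finset (Euc q)) :
    ∃ δ > (0 : ℝ), δ ≤ 1 ∧ ∀ a ∈ A, ∀ b ∈ A, a ≠ b → δ ≤ ‖a - b‖ := by
  classical
  rcases A.offDiag.eq_empty_or_nonempty with he | hne
  · refine ⟨1, one_pos, le_rfl, fun a ha b hb hab => ?_⟩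
    have : (a, b) ∈ A.offDiag := Finset.mem_offDiag.2 ⟨ha, hb, hab⟩
    simp [he] at this
  · obtain ⟨p, hp, hmin⟩ := A.offDiag.exists_min_image (fun p => ‖p.1 - p.2‖) hne
    have hpne := (Finset.mem_offDiag.1 hp).2.2
    exact ⟨min ‖p.1 - p.2‖ 1, lt_min (norm_pos_iff.2 (sub_ne_zero.2 hpne)) one_pos,
      min_le_right _ _, fun a ha b hb hab =>
        (min_le_left _ _).trans (hmin (a, b) (Finset.mem_offDiag.2 ⟨ha, hb, hab⟩))⟩

/-- global and local moment inverse bounds on a compact parameter space. -/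
theorem moment_inverse_bounds {q k : ℕ} (hk : 1 ≤ k)
    (Θ : Set (Euc q)) (hΘ : IsCompact Θ) (θ0 : Euc q) :
    ((∃ c > (0:ℝ), ∀ G H : Euc q →₀ ℝ, MixG Θ k G → MixG Θ k H → G ≠ H →
      ∃ α : Fin q → ℕ, (∑ j, α j) ≤ 2 * k - 1 ∧
        c * Wpow ((2 * k - 1 : ℕ) : ℝ) G H ≤ |momentShift θ0 α G - momentShift θ0 α H|) ∧
    (∀ k0 : ℕ, 1 ≤ k0 → k0 ≤ k → ∀ G0 : Euc q →₀ ℝ, MixE Θ k0 G0 →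
      ∃ r > (0:ℝ), ∃ c' > (0:ℝ), ∀ G H : Euc q →₀ ℝ,
        MixG Θ k G → MixG Θ k H → G ≠ H →
        Wpow 1 G G0 ≤ r → Wpow 1 H G0 ≤ r →
        ∃ α : Fin q → ℕ, (∑ j, α j) ≤ 2 * k - 1 ∧
          c' * Wpow ((2 * (k - k0 + 1) - 1 : ℕ) : ℝ) G H
            ≤ |momentShift θ0 α G - momentShift θ0 α H|)) := by
  classical
  obtain ⟨R, hR0, hR⟩ : ∃ R : ℝ, 0 ≤ R ∧ ∀ x ∈ Θ, ‖x - θ0‖ ≤ R := by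
    obtain ⟨R, hR⟩ := hΘ.isBounded.subset_closedBall θ0
    refine ⟨max R 0, le_max_right _ _, fun x hx => ?_⟩
    rw [← dist_eq_norm]
    exact (Metric.mem_closedBall.1 (hR hx)).trans (le_max_left _ _)
  set K : ℝ := 2 * (q + 1) * (1 + R) with hK
  have hq : (0 : ℝ) ≤ q := Nat.cast_nonneg q
  have hK1 : 1 ≤ K := by
    have h5 : 0 ≤ q * (1 + R) := by positivity
    rw [hK]
    linarith
  have hk0 : (0 : ℝ) < ((2 * k : ℕ) : ℝ) := by exact_mod_cast (by omega : 0 < 2 * k)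
  have hCpos : ∀ (d : ℝ) (n : ℕ), 0 < d → 0 < ((2 * k : ℕ) : ℝ) ^ 2 *
      (((2 * k : ℕ) : ℝ) ^ (n - 1) * ((K / d) ^ (2 * k) * K ^ (n - 1))) := by
    intro d n hd
    positivity
  refine ⟨⟨_, inv_pos.2 (hCpos K (2 * k) (by linarith)), fun G H hG hH _ => ?_⟩, ?_⟩
  · refine exists_moment_ge θ0 G H (hCpos K (2 * k) (by linarith)) fun ε hε hmom => ?_
    refine (Wpow_le_of_moments (by omega) hk θ0 hR0 hK (by linarith) le_rfl hε hR hG hH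
      (fun U hU hUcard => ?_) hmom).trans (le_of_eq (by ring))
    have := (Finset.card_le_card hU).trans (Finset.card_union_le G.support H.support)
    have := hG.2
    have := hH.2
    omega
  · intro k0 hk01 hk0k G0 hG0
    have hG0' : MixG Θ k0 G0 := ⟨hG0.1, hG0.2.le⟩
    obtain ⟨δ, hδ, hδ1, hsep⟩ := exists_separation G0.support
    obtain ⟨a₀, ha₀, hmin⟩ := G0.support.exists_min_image G0
      (Finset.card_pos.1 (by rw [hG0.2]; omega))
    have hp : 0 < G0 a₀ := hG0.1.1 a₀ ha₀
    have hr : ∀ a ∈ G0.support, G0 a₀ * (δ / 8) < G0 a * (δ / 4) := fun a ha =>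
      mul_lt_mul' (hmin a ha) (by linarith) (by positivity) (hG0.1.1 a ha)
    refine ⟨G0 a₀ * (δ / 8), by positivity, _,
      inv_pos.2 (hCpos (δ / 2) (2 * (k - k0 + 1)) (by positivity)),
      fun G H hG hH _ hWG hWH => ?_⟩
    refine exists_moment_ge θ0 G H (hCpos (δ / 2) (2 * (k - k0 + 1)) (by positivity))
      fun ε hε hmom => ?_
    refine (Wpow_le_of_moments (by omega) hk θ0 hR0 hK (half_pos hδ) (by linarith) hε hR hG hH
      (fun U hU hUcard => ?_) hmom).trans (le_of_eq (by ring))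
    by_contra! hdiam
    have hGU := card_inter_add_card_le hsep
      (fun a ha => exists_atom_near (hG.exists_isCoupling hG0') ha hWG (hr a ha)) hdiam
    have hHU := card_inter_add_card_le hsep
      (fun a ha => exists_atom_near (hH.exists_isCoupling hG0') ha hWH (hr a ha)) hdiam
    have hUu : U.card ≤ (U ∩ G.support).card + (U ∩ H.support).card := by
      have := Finset.card_union_le (U ∩ G.support) (U ∩ H.support)
      rwa [← Finset.inter_union_distrib_left, Finset.inter_eq_left.2 hU] at this
    have := hG.2
    have := hH.2
    have := hG0.2
    omega

end
end

section
/- Let Θ ⊆ ℝ^q, let Φ be a family of real-valued functions on Θ, and let G ∈ E_{k*}(Θ) be a discrete probability measure with exactly k* ≥ 2 atoms. Define b_G := inf_{G' ∈ G_{k*−1}(Θ)} sup_{φ∈Φ}|G'φ − Gφ|. Let T : Φ → ℝ be any function (playing the role of the empirical averages φ ↦ (1/n)Σ_{i=1}^n t_φ(X_i)), let a > 0, and for each integer ℓ ≥ 1 let Ĝ(ℓ) ∈ G_ℓ(Θ) satisfy sup_{φ∈Φ}|Ĝ(ℓ)φ − T(φ)| ≤ sup_{φ∈Φ}|G'φ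 − T(φ)| for all G' ∈ G_ℓ(Θ) (i.e., Ĝ(ℓ) is a minimizer over G_ℓ(Θ)). Define k̂ := inf{ℓ ≥ 1 : sup_{φ∈Φ}|Ĝ(ℓ)φ − T(φ)| ≤ a} (with inf ∅ = ∞). Then for every z with 0 < z ≤ a: if k̂ ≠ k*, then sup_{φ∈Φ}|Gφ − T(φ)| ≥ min(z, b_G − a). -/
open scoped BigOperators ENNReal

noncomputable section

/-- `sup_{φ ∈ Φ} |Gφ - T(φ)|`, where `T` is a data summary (e.g. empirical averages). -/
def phiDistT {q : ℕ} (Φ : Set (Euc q → ℝ)) (G : Euc q →₀ ℝ) (T : (Euc q → ℝ) → ℝ) : ℝ≥0∞ :=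
  ⨆ φ ∈ Φ, ENNReal.ofReal |mixInt G φ - T φ|

theorem phiDist_le_phiDistT_add_phiDistT {q : ℕ} (Φ : Set (Euc q → ℝ)) (G H : Euc q →₀ ℝ)
    (T : (Euc q → ℝ) → ℝ) :
    phiDist Φ G H ≤ phiDistT Φ G T + phiDistT Φ H T := by
  refine iSup₂_le fun φ hφ => ?_
  calc ENNReal.ofReal |mixInt G φ - mixInt H φ|
      ≤ ENNReal.ofReal (|mixInt G φ - T φ| + |mixInt H φ - T φ|) := by
        refine ENNReal.ofReal_le_ofReal ?_
        rw [abs_sub_comm (mixInt H φ)]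
        exact abs_sub_le _ _ _
    _ = ENNReal.ofReal |mixInt G φ - T φ| + ENNReal.ofReal |mixInt H φ - T φ| :=
        ENNReal.ofReal_add (abs_nonneg _) (abs_nonneg _)
    _ ≤ phiDistT Φ G T + phiDistT Φ H T :=
        add_le_add (le_iSup₂_of_le φ hφ le_rfl) (le_iSup₂_of_le φ hφ le_rfl)

/-- if the estimated number of components
`k̂ = inf{ℓ ≥ 1 : sup_φ |Ĝ(ℓ)φ - T(φ)| ≤ a}` differs from the true number `k*`, then the
data summary `T` deviates from `G` by at least `min(z, b_G - a)`. -/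
theorem component_number_estimation {q kstar : ℕ} (hkstar : 2 ≤ kstar)
    (Θ : Set (Euc q)) (Φ : Set (Euc q → ℝ))
    (G : Euc q →₀ ℝ) (hG : MixE Θ kstar G)
    (T : (Euc q → ℝ) → ℝ) (a : ℝ) (ha : 0 < a)
    (Ghat : ℕ → (Euc q →₀ ℝ))
    (hGhat : ∀ ℓ : ℕ, 1 ≤ ℓ → MixG Θ ℓ (Ghat ℓ) ∧
      ∀ G' : Euc q →₀ ℝ, MixG Θ ℓ G' → phiDistT Φ (Ghat ℓ) T ≤ phiDistT Φ G' T)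
    (z : ℝ) (hz : 0 < z) (hza : z ≤ a)
    (hkhat :
      sInf ((fun ℓ : ℕ => (ℓ : ℕ∞)) ''
          {ℓ : ℕ | 1 ≤ ℓ ∧ phiDistT Φ (Ghat ℓ) T ≤ ENNReal.ofReal a})
        ≠ (kstar : ℕ∞)) :
    min (ENNReal.ofReal z)
        ((⨅ (G' : Euc q →₀ ℝ) (_ : MixG Θ (kstar - 1) G'), phiDist Φ G' G)
          - ENNReal.ofReal a)
      ≤ phiDistT Φ G T := by
  by_contra! hlt
  obtain ⟨hlt_z, hlt_b⟩ := lt_min_iff.1 hlt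
  have hmem : phiDistT Φ (Ghat kstar) T ≤ ENNReal.ofReal a :=
    ((hGhat kstar (by lia)).2 G ⟨hG.1, hG.2.le⟩).trans
      (hlt_z.le.trans (ENNReal.ofReal_le_ofReal hza))
  have hsmaller : ∃ ℓ < kstar, 1 ≤ ℓ ∧ phiDistT Φ (Ghat ℓ) T ≤ ENNReal.ofReal a := by
    by_contra! hnone
    refine hkhat (le_antisymm (sInf_le ⟨kstar, ⟨by lia, hmem⟩, rfl⟩) (le_sInf ?_))
    rintro _ ⟨ℓ, ⟨hℓ, hle⟩, rfl⟩
    refine Nat.cast_le.2 (le_of_not_gt fun h => ?_)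
    exact (hnone ℓ h hℓ).not_ge hle
  obtain ⟨ℓ, hℓ_lt, hℓ, hle⟩ := hsmaller
  have hmix := (hGhat ℓ hℓ).1
  refine hlt_b.not_ge (tsub_le_iff_left.2 ?_)
  calc _ ≤ phiDist Φ (Ghat ℓ) G :=
        iInf₂_le (Ghat ℓ) ⟨hmix.1, hmix.2.trans (by lia)⟩
    _ ≤ phiDistT Φ (Ghat ℓ) T + phiDistT Φ G T := phiDist_le_phiDistT_add_phiDistT Φ _ _ T
    _ ≤ ENNReal.ofReal a + phiDistT Φ G T := by gcongr

end
end

section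
/- Let Θ ⊆ ℝ^q be compact, let 1 ≤ k0 ≤ k, and let G0 = Σ_{i=1}^{k0} p_i^0 δ_{θ_i^0} ∈ E_{k0}(Θ). Suppose Φ is a (G0,k) second-order linear independent domain (and each φ ∈ Φ is continuous on Θ). Then the inverse bound with one argument fixed holds: there exist r > 0 and c > 0 such that sup_{φ∈Φ}|Gφ − G0φ| ≥ c · W_2(G,G0)² for every G ∈ G_k(Θ) with W_1(G,G0) ≤ r. -/
open scoped BigOperators ENNReal

noncomputable section

section

open scoped Classical Topology
open Filter Asymptotics

/-- Second-order Taylor expansion with Peano remainder. -/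
theorem ContDiffAt.isLittleO_taylor_two {E : Type*} [NormedAddCommGroup E] [NormedSpace ℝ E]
    {f : E → ℝ} {y : E} (hf : ContDiffAt ℝ 2 f y) :
    (fun x => f x - (f y + fderiv ℝ f y (x - y)
      + (1 / 2) * fderiv ℝ (fderiv ℝ f) y (x - y) (x - y))) =o[𝓝 y] fun x => ‖x - y‖ ^ 2 := by
  have hsymm := hf.isSymmSndFDerivAt (by simp)
  have hd2 : DifferentiableAt ℝ (fderiv ℝ f) y :=
    (hf.fderiv_right (m := 1) (by norm_num)).differentiableAt (by norm_num)
  have hev : ∀ᶠ x in 𝓝 y, DifferentiableAt ℝ f x :=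
    (hf.eventually (by simp)).mono fun x hx => hx.differentiableAt (by norm_num)
  rw [isLittleO_iff]
  intro ε hε
  have h1 := (isLittleO_iff.1 hd2.hasFDerivAt.isLittleO hε).and hev
  obtain ⟨r, hr, hball⟩ := Metric.eventually_nhds_iff_ball.1 h1
  filter_upwards [Metric.ball_mem_nhds y hr] with x hx
  set B := fderiv ℝ (fderiv ℝ f) y with hB
  set g : E → ℝ := fun z => f z - (f y + fderiv ℝ f y (z - y) + (1 / 2) * B (z - y) (z - y)) with hg
  have hgd : ∀ z ∈ Metric.ball y r, HasFDerivAt g (fderiv ℝ f z - fderiv ℝ f y - B (z - y)) z := by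
    intro z hz
    have hid : HasFDerivAt (fun z => z - y) (ContinuousLinearMap.id ℝ E) z :=
      (hasFDerivAt_id z).sub_const y
    have hlin := (fderiv ℝ f y).hasFDerivAt.comp z hid
    have hquad := ((B.hasFDerivAt.comp z hid).clm_apply hid).const_mul (1 / 2 : ℝ)
    have h := (hball z hz).2.hasFDerivAt.sub ((hlin.const_add (f y)).add hquad)
    refine h.congr_fderiv ?_
    ext v
    have := hsymm v (z - y)
    simp [← hB] at this ⊢
    rw [this]; ring
  have hseg : segment ℝ y x ⊆ Metric.ball y r :=
    (convex_ball y r).segment_subset (Metric.mem_ball_self hr) hx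
  have hbound : ∀ z ∈ segment ℝ y x,
      ‖fderiv ℝ f z - fderiv ℝ f y - B (z - y)‖ ≤ ε * ‖x - y‖ := by
    intro z hz
    refine ((hball z (hseg hz)).1).trans ?_
    gcongr
    have := norm_sub_le_of_mem_segment hz
    simpa [norm_sub_rev] using this
  have h := (convex_segment y x).norm_image_sub_le_of_norm_hasFDerivWithin_le
    (fun z hz => (hgd z (hseg hz)).hasFDerivWithinAt) hbound
    (left_mem_segment ℝ y x) (right_mem_segment ℝ y x)
  have hgy : g y = 0 := by simp [hg]
  rw [hgy, sub_zero] at h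
  calc ‖g x‖ ≤ ε * ‖x - y‖ * ‖x - y‖ := h
    _ = ε * ‖‖x - y‖ ^ 2‖ := by simp; ring

theorem mem_multiIdx_of_sum_le {q n : ℕ} (α : Fin q → ℕ) (hα : ∑ j, α j ≤ n) :
    α ∈ multiIdx q n := by
  simp only [multiIdx, Finset.mem_filter, Fintype.mem_piFinset, Finset.mem_range]
  refine ⟨fun a => Nat.lt_succ_of_le (le_trans ?_ hα), hα⟩
  exact Finset.single_le_sum (f := α) (fun _ _ => Nat.zero_le _) (Finset.mem_univ a)

theorem multiIdx_zero (q : ℕ) : multiIdx q 0 = {0} := by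
  ext α
  simp only [multiIdx, Finset.mem_filter, Fintype.mem_piFinset, Finset.mem_range,
    Finset.mem_singleton]
  constructor
  · rintro ⟨h, -⟩
    funext a
    have := h a
    simp; omega
  · rintro rfl
    simp

theorem Dmulti_zero {q : ℕ} (f : Euc q → ℝ) : Dmulti 0 f = f := by
  have : ((List.finRange q).flatMap fun i => List.replicate ((0 : Fin q → ℕ) i) i) = [] := by
    simp
  rw [Dmulti, this, pderivSeq]

theorem count_flatMap_replicate {q : ℕ} (α : Fin q → ℕ) (c : Fin q) :
    ((List.finRange q).flatMap fun i => List.replicate (α i) i).count c = α c := by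
  rw [List.count_flatMap]
  have : (List.count c ∘ fun i => List.replicate (α i) i)
      = fun i => if i = c then α i else 0 := by
    funext i
    simp [List.count_replicate]
  rw [this, ← List.ofFn_eq_map, List.sum_ofFn]
  simp

theorem Dmulti_single {q : ℕ} (a : Fin q) (f : Euc q → ℝ) (x : Euc q) :
    Dmulti (Pi.single a 1) f x = fderiv ℝ f x (EuclideanSpace.single a 1) := by
  have h : ((List.finRange q).flatMap fun i =>
      List.replicate ((Pi.single a 1 : Fin q → ℕ) i) i) = [a] := by
    rw [← List.perm_singleton, List.perm_iff_count]
    intro c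
    rw [count_flatMap_replicate]
    by_cases h : a = c
    · simp [h]
    · simp [h, Ne.symm h]
  rw [Dmulti, h]
  rfl

theorem pderivSeq_pair {q : ℕ} (a b : Fin q) {f : Euc q → ℝ} {x : Euc q}
    (hf : ContDiffAt ℝ 2 f x) :
    pderivSeq [a, b] f x = fderiv ℝ (fderiv ℝ f) x
      (EuclideanSpace.single b 1) (EuclideanSpace.single a 1) := by
  have hd2 : DifferentiableAt ℝ (fderiv ℝ f) x :=
    (hf.fderiv_right (m := 1) (by norm_num)).differentiableAt (by norm_num)
  have h := (hd2.hasFDerivAt.clm_apply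
    (hasFDerivAt_const (EuclideanSpace.single a (1 : ℝ)) x)).fderiv
  simp only [pderivSeq]
  rw [h]
  simp

theorem Dmulti_single_add_single {q : ℕ} (a b : Fin q) {f : Euc q → ℝ} {x : Euc q}
    (hf : ContDiffAt ℝ 2 f x) :
    Dmulti (Pi.single a 1 + Pi.single b 1) f x = fderiv ℝ (fderiv ℝ f) x
      (EuclideanSpace.single a 1) (EuclideanSpace.single b 1) := by
  have h : ((List.finRange q).flatMap fun i =>
      List.replicate ((Pi.single a 1 + Pi.single b 1 : Fin q → ℕ) i) i).Perm [a, b] := by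
    rw [List.perm_iff_count]
    intro c
    rw [count_flatMap_replicate]
    simp only [Pi.add_apply, Pi.single_apply, List.count_cons, List.count_nil, beq_iff_eq]
    grind
  rcases List.perm_pair.1 h with h | h
  · rw [Dmulti, h, pderivSeq_pair a b hf]
    exact hf.isSymmSndFDerivAt (by simp) _ _
  · rw [Dmulti, h, pderivSeq_pair b a hf]

/-- The coefficient family on multi-indices of a second-order differential operator. -/
def jetCoeff {q : ℕ} (α : ℝ) (β : Fin q → ℝ) (γ : Fin q → Fin q → ℝ) (m : Fin q → ℕ) : ℝ :=
  (if m = 0 then α else 0) + ∑ a, (if m = Pi.single a 1 then β a else 0)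
    + ∑ a, ∑ b, (if m = Pi.single a 1 + Pi.single b 1 then γ a b else 0)

theorem jetCoeff_zero {q : ℕ} (α : ℝ) (β : Fin q → ℝ) (γ : Fin q → Fin q → ℝ) :
    jetCoeff α β γ 0 = α := by
  have h1 : ∀ a : Fin q, (0 : Fin q → ℕ) ≠ Pi.single a 1 := fun a h => by
    simpa using congrFun h a
  have h2 : ∀ a b : Fin q, (0 : Fin q → ℕ) ≠ Pi.single a 1 + Pi.single b 1 := fun a b h => by
    have := congrFun h a
    simp at this
    omega
  simp [jetCoeff, h1, h2]

theorem jetCoeff_single {q : ℕ} (α : ℝ) (β : Fin q → ℝ) (γ : Fin q → Fin q → ℝ) (c : Fin q) :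
    jetCoeff α β γ (Pi.single c 1) = β c := by
  have h2 : ∀ a b : Fin q, (Pi.single c 1 : Fin q → ℕ) ≠ Pi.single a 1 + Pi.single b 1 :=
    fun a b h => by
      have := congrArg (fun m : Fin q → ℕ => ∑ j, m j) h
      simp [Finset.sum_add_distrib] at this
  have h3 : ∀ a : Fin q, (Pi.single c 1 : Fin q → ℕ) = Pi.single a 1 ↔ c = a := fun a =>
    ⟨fun h => by
      by_contra hne
      simpa [hne] using congrFun h c, fun h => by rw [h]⟩
  simp [jetCoeff, h2, h3]

theorem jetCoeff_single_add_single {q : ℕ} (α : ℝ) (β : Fin q → ℝ) (γ : Fin q → Fin q → ℝ)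
    (c : Fin q) : jetCoeff α β γ (Pi.single c 1 + Pi.single c 1) = γ c c := by
  have h2 : ∀ a : Fin q, (Pi.single c 1 + Pi.single c 1 : Fin q → ℕ) ≠ Pi.single a 1 :=
    fun a h => by
      have := congrArg (fun m : Fin q → ℕ => ∑ j, m j) h
      simp [Finset.sum_add_distrib] at this
  have h1 : (Pi.single c 1 + Pi.single c 1 : Fin q → ℕ) ≠ 0 := fun h => by
    simpa using congrFun h c
  have h3 : ∀ a b : Fin q, (Pi.single c 1 + Pi.single c 1 : Fin q → ℕ)
      = Pi.single a 1 + Pi.single b 1 ↔ c = a ∧ c = b := fun a b => by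
    rw [Pi.single_add_single_eq_single_add_single one_ne_zero one_ne_zero]
    simp; tauto
  simp [jetCoeff, h1, h2, h3, ite_and]

theorem sum_jetCoeff_mul_Dmulti {q : ℕ} (α : ℝ) (β : Fin q → ℝ) (γ : Fin q → Fin q → ℝ)
    {f : Euc q → ℝ} {x : Euc q} (hf : ContDiffAt ℝ 2 f x) :
    ∑ m ∈ multiIdx q 2, jetCoeff α β γ m * Dmulti m f x
      = α * f x + (∑ a, β a * fderiv ℝ f x (EuclideanSpace.single a 1)
        + ∑ a, ∑ b, γ a b * fderiv ℝ (fderiv ℝ f) x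
          (EuclideanSpace.single a 1) (EuclideanSpace.single b 1)) := by
  have hm0 : (0 : Fin q → ℕ) ∈ multiIdx q 2 := mem_multiIdx_of_sum_le _ (by simp)
  have hm1 : ∀ a, (Pi.single a 1 : Fin q → ℕ) ∈ multiIdx q 2 := fun a =>
    mem_multiIdx_of_sum_le _ (by simp)
  have hm2 : ∀ a b, (Pi.single a 1 + Pi.single b 1 : Fin q → ℕ) ∈ multiIdx q 2 := fun a b =>
    mem_multiIdx_of_sum_le _ (by simp [Finset.sum_add_distrib])
  have key : ∀ (m₀ : Fin q → ℕ) (v : ℝ), m₀ ∈ multiIdx q 2 →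
      ∑ m ∈ multiIdx q 2, (if m = m₀ then v else 0) * Dmulti m f x = v * Dmulti m₀ f x := by
    intro m₀ v h
    simp [ite_mul, h]
  simp only [jetCoeff, add_mul, Finset.sum_mul, Finset.sum_add_distrib]
  rw [key 0 α hm0, Dmulti_zero, Finset.sum_comm, add_assoc]
  congr 2
  · refine Finset.sum_congr rfl fun a _ => ?_
    rw [key _ _ (hm1 a), Dmulti_single]
  · rw [Finset.sum_comm]
    refine Finset.sum_congr rfl fun a _ => ?_
    rw [Finset.sum_comm]
    refine Finset.sum_congr rfl fun b _ => ?_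
    rw [key _ _ (hm2 a b), Dmulti_single_add_single a b hf]

/-- Reformulation of second-order linear independence over a finite set of points `L` containing
the atoms `S`. -/
theorem jet_coeff_eq_zero {q k k0 : ℕ} (hk0 : 1 ≤ k0) {Θ : Set (Euc q)} {Φ : Set (Euc q → ℝ)}
    {S : Finset (Euc q)} (hS : S.card = k0)
    (hsmooth : ∀ φ ∈ Φ, ∀ x ∈ S, ContDiffAt ℝ 2 φ x)
    (hind : ∀ ℓ1 ℓ : ℕ, 1 ≤ ℓ1 → ℓ1 ≤ k0 → k0 ≤ ℓ → ℓ ≤ k →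
      ∀ θ : Fin ℓ → Euc q, Function.Injective θ →
        (∀ i : Fin ℓ, (i : ℕ) < k0 → θ i ∈ S) →
        (∀ i : Fin ℓ, k0 ≤ (i : ℕ) → θ i ∈ Θ ∧ θ i ∉ S) →
      ∀ a : Fin ℓ → (Fin q → ℕ) → ℝ,
        (∀ φ ∈ Φ, ∑ i : Fin ℓ,
            ∑ α ∈ multiIdx q (if (i : ℕ) < ℓ1 then 2 else if (i : ℕ) < k0 then 1 else 0),
              a i α * Dmulti α φ (θ i) = 0) →
        (∑ i : Fin ℓ, a i 0 = 0) →
        ∀ i : Fin ℓ,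
          ∀ α ∈ multiIdx q (if (i : ℕ) < ℓ1 then 2 else if (i : ℕ) < k0 then 1 else 0),
            a i α = 0)
    {L : Finset (Euc q)} (hSL : S ⊆ L) (hLΘ : ∀ x ∈ L, x ∈ Θ) (hLk : L.card ≤ k)
    (α : Euc q → ℝ) (β : Euc q → Fin q → ℝ) (γ : Euc q → Fin q → Fin q → ℝ)
    (hzero : ∀ φ ∈ Φ, ∑ y ∈ L, α y * φ y
      + ∑ y ∈ S, (∑ a, β y a * fderiv ℝ φ y (EuclideanSpace.single a 1)
        + ∑ a, ∑ b, γ y a b * fderiv ℝ (fderiv ℝ φ) y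
          (EuclideanSpace.single a 1) (EuclideanSpace.single b 1)) = 0)
    (hsum : ∑ y ∈ L, α y = 0) :
    (∀ y ∈ L, α y = 0) ∧ ∀ y ∈ S, (∀ a, β y a = 0) ∧ ∀ a, γ y a a = 0 := by
  classical
  set n := (L \ S).card with hn
  have hcard : k0 + n = L.card := by
    rw [hn, Finset.card_sdiff_of_subset hSL, hS]
    have := Finset.card_le_card hSL
    omega
  let e₁ : Fin k0 ≃ S := (S.equivFinOfCardEq hS).symm
  let e₂ : Fin n ≃ (L \ S : Finset (Euc q)) := (Finset.equivFin _).symm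
  let θ : Fin (k0 + n) → Euc q := Fin.append (fun i => (e₁ i : Euc q)) (fun i => (e₂ i : Euc q))
  have hθ₁ : ∀ i, θ (Fin.castAdd n i) = e₁ i := fun i => by simp [θ]
  have hθ₂ : ∀ i, θ (Fin.natAdd k0 i) = e₂ i := fun i => by simp [θ]
  have hmem₂ : ∀ i, (e₂ i : Euc q) ∈ L ∧ (e₂ i : Euc q) ∉ S := fun i =>
    Finset.mem_sdiff.1 (e₂ i).2
  have hsplit : ∀ F : Euc q → ℝ, ∑ y ∈ L, F y = ∑ i, F (e₁ i) + ∑ i, F (e₂ i) := by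
    intro F
    rw [← Finset.sum_sdiff hSL, add_comm, ← Finset.sum_coe_sort S, ← Finset.sum_coe_sort (L \ S),
      ← e₁.sum_comp, ← e₂.sum_comp]
  have hinj : Function.Injective θ := by
    intro i j
    refine Fin.addCases (fun i => ?_) (fun i => ?_) i <;>
      refine Fin.addCases (fun j => ?_) (fun j => ?_) j
    · rw [hθ₁, hθ₁]; intro h; rw [e₁.injective (Subtype.ext h)]
    · rw [hθ₁, hθ₂]; intro h; exact absurd (h ▸ (e₁ i).2) (hmem₂ j).2
    · rw [hθ₁, hθ₂]; intro h; exact absurd (h ▸ (e₁ j).2) (hmem₂ i).2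
    · rw [hθ₂, hθ₂]; intro h; rw [e₂.injective (Subtype.ext h)]
  have main := hind k0 (k0 + n) hk0 le_rfl (by omega) (by omega) θ hinj
    (fun i => Fin.addCases (fun i _ => by rw [hθ₁]; exact (e₁ i).2)
      (fun i hi => by simp at hi) i)
    (fun i => Fin.addCases (fun i hi => by simp at hi; omega)
      (fun i _ => by rw [hθ₂]; exact ⟨hLΘ _ (hmem₂ i).1, (hmem₂ i).2⟩) i)
    (fun i => jetCoeff (α (θ i)) (β (θ i)) (γ (θ i)))
    (by
      intro φ hφ
      rw [← hzero φ hφ, Fin.sum_univ_add, hsplit]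
      simp only [Fin.val_castAdd, Fin.is_lt, if_true, Fin.val_natAdd,
        not_lt_of_ge (Nat.le_add_right _ _), if_false, multiIdx_zero, Finset.sum_singleton,
        jetCoeff_zero, Dmulti_zero, hθ₁, hθ₂]
      rw [← Finset.sum_coe_sort S, ← e₁.sum_comp, add_right_comm, ← Finset.sum_add_distrib]
      congr 1
      exact Finset.sum_congr rfl fun i _ =>
        sum_jetCoeff_mul_Dmulti _ _ _ (hsmooth φ hφ _ (e₁ i).2))
    (by
      simp only [jetCoeff_zero]
      rw [← hsum, Fin.sum_univ_add, hsplit]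
      simp only [hθ₁, hθ₂])
  have hS' : ∀ y ∈ S, ∀ m ∈ multiIdx q 2, jetCoeff (α y) (β y) (γ y) m = 0 := by
    intro y hy m hm
    have h := main (Fin.castAdd n (e₁.symm ⟨y, hy⟩)) m (by simpa using hm)
    simpa [hθ₁] using h
  refine ⟨fun y hy => ?_, fun y hy => ⟨fun a => ?_, fun a => ?_⟩⟩
  · by_cases hyS : y ∈ S
    · simpa [jetCoeff_zero] using hS' y hyS 0 (mem_multiIdx_of_sum_le _ (by simp))
    · have h := main (Fin.natAdd k0 (e₂.symm ⟨y, Finset.mem_sdiff.2 ⟨hy, hyS⟩⟩)) 0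
        (mem_multiIdx_of_sum_le _ (by simp))
      simpa [hθ₂, jetCoeff_zero] using h
  · simpa [jetCoeff_single] using
      hS' y hy (Pi.single a 1) (mem_multiIdx_of_sum_le _ (by simp))
  · rw [← jetCoeff_single_add_single (α y) (β y) (γ y) a]
    exact hS' y hy (Pi.single a 1 + Pi.single a 1)
        (mem_multiIdx_of_sum_le _ (by simp [Finset.sum_add_distrib]))

/-- A sub-coupling extends to a coupling, with the cost of the remaining mass controlled by a
bound `D` on the cost function. -/
theorem exists_isCoupling_of_subcoupling {q : ℕ} {G H : Euc q →₀ ℝ}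
    (hG1 : ∑ x ∈ G.support, G x = 1) (hH1 : ∑ y ∈ H.support, H y = 1)
    {ρ : Euc q × Euc q → ℝ} (hρ : ∀ p, 0 ≤ ρ p)
    (hrow : ∀ x, ∑ y ∈ H.support, ρ (x, y) ≤ G x)
    (hcol : ∀ y, ∑ x ∈ G.support, ρ (x, y) ≤ H y)
    {D : ℝ} {c : Euc q × Euc q → ℝ} (hc : ∀ p ∈ G.support ×ˢ H.support, c p ≤ D) :
    ∃ π, IsCoupling G H π ∧ ∑ p ∈ G.support ×ˢ H.support, π p * c p
      ≤ ∑ p ∈ G.support ×ˢ H.support, ρ p * c p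
        + D * (1 - ∑ y ∈ H.support, ∑ x ∈ G.support, ρ (x, y)) := by
  set a : Euc q → ℝ := fun x => G x - ∑ y ∈ H.support, ρ (x, y) with ha
  set b : Euc q → ℝ := fun y => H y - ∑ x ∈ G.support, ρ (x, y) with hb
  set R : ℝ := 1 - ∑ y ∈ H.support, ∑ x ∈ G.support, ρ (x, y) with hR
  have ha0 : ∀ x, 0 ≤ a x := fun x => sub_nonneg.2 (hrow x)
  have hb0 : ∀ y, 0 ≤ b y := fun y => sub_nonneg.2 (hcol y)
  have hbR : ∑ y ∈ H.support, b y = R := by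
    rw [hb, Finset.sum_sub_distrib, hH1]
  have haR : ∑ x ∈ G.support, a x = R := by
    rw [ha, Finset.sum_sub_distrib, hG1, Finset.sum_comm]
  have hR0 : 0 ≤ R := hbR ▸ Finset.sum_nonneg fun y _ => hb0 y
  have hadiv : ∀ x ∈ G.support, a x * R / R = a x := by
    intro x hx
    rcases eq_or_ne R 0 with h | h
    · rw [h] at haR
      have := (Finset.sum_eq_zero_iff_of_nonneg fun x _ => ha0 x).1 haR x hx
      simp [this]
    · field_simp
  have hbdiv : ∀ y ∈ H.support, R * b y / R = b y := by
    intro y hy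
    rcases eq_or_ne R 0 with h | h
    · rw [h] at hbR
      have := (Finset.sum_eq_zero_iff_of_nonneg fun x _ => hb0 x).1 hbR y hy
      simp [this]
    · field_simp
  have hab0 : ∀ p : Euc q × Euc q, 0 ≤ a p.1 * b p.2 / R := fun p =>
    div_nonneg (mul_nonneg (ha0 _) (hb0 _)) hR0
  refine ⟨fun p => ρ p + a p.1 * b p.2 / R, ⟨fun p => add_nonneg (hρ p) (hab0 p), ?_, ?_⟩, ?_⟩
  · intro x hx
    rw [Finset.sum_add_distrib]
    dsimp only
    rw [← Finset.sum_div, ← Finset.mul_sum, hbR, hadiv x hx]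
    simp [ha]
  · intro y hy
    rw [Finset.sum_add_distrib]
    dsimp only
    rw [← Finset.sum_div, ← Finset.sum_mul, haR, hbdiv y hy]
    simp [hb]
  · simp only [add_mul, Finset.sum_add_distrib]
    gcongr
    calc ∑ p ∈ G.support ×ˢ H.support, a p.1 * b p.2 / R * c p
        ≤ ∑ p ∈ G.support ×ˢ H.support, a p.1 * b p.2 / R * D :=
          Finset.sum_le_sum fun p hp => mul_le_mul_of_nonneg_left (hc p hp) (hab0 p)
      _ = D * ∑ x ∈ G.support, a x := by
          rw [← Finset.sum_mul, Finset.sum_product, mul_comm]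
          congr 1
          refine Finset.sum_congr rfl fun x hx => ?_
          dsimp only
          rw [← Finset.sum_div, ← Finset.mul_sum, hbR, hadiv x hx]
      _ = D * R := by rw [haR]

theorem IsMixingMeasure.nonneg {q : ℕ} {Θ : Set (Euc q)} {G : Euc q →₀ ℝ}
    (hG : IsMixingMeasure Θ G) (x : Euc q) : 0 ≤ G x := by
  by_cases hx : x ∈ G.support
  · exact (hG.1 x hx).le
  · exact (Finsupp.notMem_support_iff.1 hx).ge

theorem Wpow_le_of_isCoupling {q : ℕ} {G H : Euc q →₀ ℝ} {π : Euc q × Euc q → ℝ}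
    (hπ : IsCoupling G H π) (ℓ : ℝ) :
    Wpow ℓ G H ≤ ∑ p ∈ G.support ×ˢ H.support, π p * ‖p.1 - p.2‖ ^ ℓ := by
  refine csInf_le ⟨0, ?_⟩ ⟨π, hπ, rfl⟩
  rintro c ⟨π', hπ', rfl⟩
  exact Finset.sum_nonneg fun p _ =>
    mul_nonneg (hπ'.1 p) (Real.rpow_nonneg (norm_nonneg _) _)

/-- If every atom of `G` is at distance at least `ε` from an atom `y` of `H`, then the
transport cost is at least `ε * H y`. -/
theorem mul_le_Wpow_one {q : ℕ} {Θ : Set (Euc q)} {G H : Euc q →₀ ℝ}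
    (hG : IsMixingMeasure Θ G) (hH : IsMixingMeasure Θ H) {y : Euc q} (hy : y ∈ H.support)
    {ε : ℝ} (hε : ∀ x ∈ G.support, ε ≤ ‖x - y‖) : ε * H y ≤ Wpow 1 G H := by
  obtain ⟨π₀, hπ₀, -⟩ := exists_isCoupling_of_subcoupling hG.2.1 hH.2.1 (ρ := fun _ => 0)
    (fun _ => le_rfl) (fun x => by simpa using hG.nonneg x) (fun x => by simpa using hH.nonneg x)
    (c := fun _ => 0) (D := 0) (fun _ _ => le_rfl)
  refine le_csInf ⟨_, π₀, hπ₀, rfl⟩ ?_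
  rintro c ⟨π, hπ, rfl⟩
  simp only [Real.rpow_one]
  rw [Finset.sum_product_right, ← hπ.2.2 y hy, Finset.mul_sum]
  calc ∑ x ∈ G.support, ε * π (x, y) ≤ ∑ x ∈ G.support, π (x, y) * ‖x - y‖ :=
        Finset.sum_le_sum fun x hx => by
          rw [mul_comm]
          exact mul_le_mul_of_nonneg_left (hε x hx) (hπ.1 _)
    _ ≤ _ := Finset.single_le_sum
        (f := fun y => ∑ x ∈ G.support, π (x, y) * ‖x - y‖)
        (fun y _ => Finset.sum_nonneg fun x _ => mul_nonneg (hπ.1 _) (norm_nonneg _)) hy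

/-- Transport bound obtained by sending each atom of `G` to the unique atom of `H` near it, as far
as masses allow. -/
theorem Wpow_two_le_of_near {q : ℕ} {Θ : Set (Euc q)} {G H : Euc q →₀ ℝ}
    (hG : IsMixingMeasure Θ G) (hH : IsMixingMeasure Θ H) {D : ℝ} (hD : 0 ≤ D)
    (hdiam : ∀ x ∈ Θ, ∀ y ∈ Θ, ‖x - y‖ ^ 2 ≤ D) {ε : ℝ}
    (hsep : ∀ x, ∀ y ∈ H.support, ∀ y' ∈ H.support, ‖x - y‖ < ε → ‖x - y'‖ < ε → y = y') :
    Wpow 2 G H ≤ ∑ y ∈ H.support, ∑ x ∈ G.support,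
          G x * (if ‖x - y‖ < ε then ‖x - y‖ ^ 2 else 0)
      + D * ∑ y ∈ H.support, |∑ x ∈ G.support, G x * (if ‖x - y‖ < ε then 1 else 0) - H y| := by
  set m : Euc q → ℝ := fun y => ∑ x ∈ G.support, G x * (if ‖x - y‖ < ε then 1 else 0) with hm
  have hm0 : ∀ y, 0 ≤ m y := fun y => Finset.sum_nonneg fun x _ =>
    mul_nonneg (hG.nonneg x) (by split_ifs <;> norm_num)
  set t : Euc q → ℝ := fun y => min (m y) (H y) / m y with ht
  have ht0 : ∀ y, 0 ≤ t y := fun y => div_nonneg (le_min (hm0 y) (hH.nonneg y)) (hm0 y)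
  have ht1 : ∀ y, t y ≤ 1 := fun y => div_le_one_of_le₀ (min_le_left _ _) (hm0 y)
  have hmt : ∀ y, m y * t y = min (m y) (H y) := by
    intro y
    rcases eq_or_ne (m y) 0 with h | h
    · simp [h, hH.nonneg y]
    · simp only [ht]; field_simp
  set ρ : Euc q × Euc q → ℝ :=
    fun p => G p.1 * (if ‖p.1 - p.2‖ < ε then 1 else 0) * t p.2 with hρ
  have hρ0 : ∀ p, 0 ≤ ρ p := fun p =>
    mul_nonneg (mul_nonneg (hG.nonneg _) (by split_ifs <;> norm_num)) (ht0 _)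
  have hcol : ∀ y, ∑ x ∈ G.support, ρ (x, y) = min (m y) (H y) := by
    intro y
    rw [← hmt, hm, Finset.sum_mul]
  have hrow : ∀ x, ∑ y ∈ H.support, ρ (x, y) ≤ G x := by
    intro x
    by_cases h : ∃ y₀ ∈ H.support, ‖x - y₀‖ < ε
    · obtain ⟨y₀, hy₀, hxy₀⟩ := h
      rw [Finset.sum_eq_single_of_mem y₀ hy₀]
      · simpa [hρ, hxy₀] using mul_le_of_le_one_right (hG.nonneg x) (ht1 y₀)
      · intro y hy hne
        have : ¬ ‖x - y‖ < ε := fun hlt => hne (hsep x y hy y₀ hy₀ hlt hxy₀)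
        simp [hρ, this]
    · push Not at h
      rw [Finset.sum_eq_zero]
      · exact hG.nonneg x
      · intro y hy
        simp [hρ, not_lt.2 (h y hy)]
  obtain ⟨π, hπ, hcost⟩ := exists_isCoupling_of_subcoupling hG.2.1 hH.2.1 hρ0 hrow
    (fun y => (hcol y).trans_le (min_le_right _ _)) (D := D) (c := fun p => ‖p.1 - p.2‖ ^ (2 : ℝ))
    (fun p hp => by
      rw [Finset.mem_product] at hp
      rw [Real.rpow_two]
      exact hdiam _ (hG.2.2 hp.1) _ (hH.2.2 hp.2))
  refine (Wpow_le_of_isCoupling hπ 2).trans (hcost.trans ?_)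
  gcongr
  · rw [Finset.sum_product_right]
    refine Finset.sum_le_sum fun y _ => Finset.sum_le_sum fun x _ => ?_
    simp only [hρ, Real.rpow_two]
    by_cases h : ‖x - y‖ < ε
    · simp only [h, if_true, mul_one]
      gcongr
      exact mul_le_of_le_one_right (hG.nonneg x) (ht1 y)
    · simp [h]
  · refine (sub_le_sub_right hH.2.1.ge _).trans ?_
    rw [← Finset.sum_sub_distrib]
    refine Finset.sum_le_sum fun y _ => ?_
    rw [hcol]
    rcases le_total (m y) (H y) with h | h
    · rw [min_eq_left h, abs_sub_comm]; exact le_abs_self (H y - m y)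
    · rw [min_eq_right h]; simp

theorem IsMixingMeasure.exists_fin_param {q k : ℕ} {Θ : Set (Euc q)} {G : Euc q →₀ ℝ}
    (hG : IsMixingMeasure Θ G) (hk : G.support.card ≤ k) :
    ∃ (w : Fin k → ℝ) (x : Fin k → Euc q), (∀ j, 0 ≤ w j) ∧ (∀ j, x j ∈ G.support) ∧
      (∀ u ∈ G.support, ∃ j, x j = u) ∧
      ∀ f : Euc q → ℝ, ∑ z ∈ G.support, G z * f z = ∑ j, w j * f (x j) := by
  classical
  have hne : G.support.Nonempty := by
    rw [Finset.nonempty_iff_ne_empty]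
    intro h
    simpa [h] using hG.2.1
  have : Nonempty G.support := hne.to_subtype
  obtain ⟨e⟩ : Nonempty (G.support ↪ Fin k) :=
    Function.Embedding.nonempty_of_card_le (by simpa using hk)
  refine ⟨fun j => ∑ s : G.support, if e s = j then G s else 0,
    fun j => (Function.invFun e j : G.support), fun j => ?_,
    fun j => (Function.invFun e j).2,
    fun u hu => ⟨e ⟨u, hu⟩, congrArg Subtype.val (Function.leftInverse_invFun e.injective _)⟩, fun f => ?_⟩
  · exact Finset.sum_nonneg fun s _ => by split_ifs <;> simp [hG.nonneg]
  · simp only [Finset.sum_mul]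
    rw [Finset.sum_comm, ← Finset.sum_coe_sort]
    refine Finset.sum_congr rfl fun s _ => ?_
    simp [ite_mul, Function.leftInverse_invFun e.injective s]

theorem clm_apply_eq_sum {q : ℕ} (T : Euc q →L[ℝ] ℝ) (v : Euc q) :
    T v = ∑ a, v a * T (EuclideanSpace.single a 1) := by
  conv_lhs => rw [← (EuclideanSpace.basisFun (Fin q) ℝ).sum_repr v]
  simp

theorem clm_apply_apply_eq_sum {q : ℕ} (T : Euc q →L[ℝ] Euc q →L[ℝ] ℝ) (v : Euc q) :
    T v v = ∑ a, ∑ b, v a * v b *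
      T (EuclideanSpace.single a 1) (EuclideanSpace.single b 1) := by
  have h := clm_apply_eq_sum (T.flip v) v
  simp only [ContinuousLinearMap.flip_apply] at h
  rw [h]
  refine Finset.sum_congr rfl fun a _ => ?_
  rw [clm_apply_eq_sum, Finset.mul_sum]
  exact Finset.sum_congr rfl fun b _ => by ring

/-- Excess over `G0` of the total weight of the points clustering at `y`. -/
def clusterMass {q k : ℕ} (G0 : Euc q →₀ ℝ) (w : Fin k → ℝ) (z : Fin k → Euc q)
    (y : Euc q) : ℝ :=
  ∑ j, (if z j = y then w j else 0) - G0 y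

/-- First-order moments of the points `x j` clustering at `y`. -/
def clusterFirst {q k : ℕ} (w : Fin k → ℝ) (x z : Fin k → Euc q) (y : Euc q)
    (a : Fin q) : ℝ :=
  ∑ j, if z j = y then w j * (x j - y) a else 0

/-- Halved second-order moments of the points `x j` clustering at `y`. -/
def clusterSecond {q k : ℕ} (w : Fin k → ℝ) (x z : Fin k → Euc q) (y : Euc q)
    (a b : Fin q) : ℝ :=
  ∑ j, if z j = y then w j * (1 / 2 * ((x j - y) a * (x j - y) b)) else 0

/-- Total size of the coefficients in the expansion of `G - G0`. -/
def clusterScale {q k : ℕ} (G0 : Euc q →₀ ℝ) (w : Fin k → ℝ) (x z : Fin k → Euc q) : ℝ :=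
  ∑ y ∈ Finset.univ.image z, |clusterMass G0 w z y|
    + ∑ y ∈ G0.support, (∑ a, |clusterFirst w x z y a| + ∑ a, clusterSecond w x z y a a)

/-- The second-order Taylor polynomial of `φ` at `y`, without constant term. -/
def taylorTwo {q : ℕ} (φ : Euc q → ℝ) (y v : Euc q) : ℝ :=
  ∑ a, v a * fderiv ℝ φ y (EuclideanSpace.single a 1)
    + 1 / 2 * ∑ a, ∑ b, v a * v b * fderiv ℝ (fderiv ℝ φ) y
      (EuclideanSpace.single a 1) (EuclideanSpace.single b 1)

/-- The remainder of `φ x` after a Taylor expansion at `z`: of order two at the atoms of `G0`, of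
order zero elsewhere. -/
def clusterRem {q : ℕ} (G0 : Euc q →₀ ℝ) (φ : Euc q → ℝ) (x z : Euc q) : ℝ :=
  φ x - φ z - (if z ∈ G0.support then taylorTwo φ z (x - z) else 0)

theorem cluster_expansion {q k : ℕ} {G0 : Euc q →₀ ℝ} {w : Fin k → ℝ} {x z : Fin k → Euc q}
    (hSz : G0.support ⊆ Finset.univ.image z) (φ : Euc q → ℝ) :
    ∑ j, w j * φ (x j) - ∑ y ∈ G0.support, G0 y * φ y
      = (∑ y ∈ Finset.univ.image z, clusterMass G0 w z y * φ y
        + ∑ y ∈ G0.support,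
          (∑ a, clusterFirst w x z y a * fderiv ℝ φ y (EuclideanSpace.single a 1)
            + ∑ a, ∑ b, clusterSecond w x z y a b * fderiv ℝ (fderiv ℝ φ) y
              (EuclideanSpace.single a 1) (EuclideanSpace.single b 1)))
        + ∑ j, w j * clusterRem G0 φ (x j) (z j) := by
  have h0 : ∑ y ∈ Finset.univ.image z, clusterMass G0 w z y * φ y
      = ∑ j, w j * φ (z j) - ∑ y ∈ G0.support, G0 y * φ y := by
    simp only [clusterMass, sub_mul, Finset.sum_sub_distrib, Finset.sum_mul]
    congr 1
    · rw [Finset.sum_comm]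
      refine Finset.sum_congr rfl fun j _ => ?_
      simp [ite_mul]
    · symm
      refine Finset.sum_subset hSz fun y _ hy => ?_
      simp [Finsupp.notMem_support_iff.1 hy]
  have h1 : ∀ y, (∑ a, clusterFirst w x z y a * fderiv ℝ φ y (EuclideanSpace.single a 1)
            + ∑ a, ∑ b, clusterSecond w x z y a b * fderiv ℝ (fderiv ℝ φ) y
              (EuclideanSpace.single a 1) (EuclideanSpace.single b 1))
      = ∑ j, if z j = y then w j * taylorTwo φ y (x j - y) else 0 := by
    intro y
    simp only [clusterFirst, clusterSecond, taylorTwo, Finset.sum_mul]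
    have e1 : ∀ F : Fin q → Fin k → ℝ, ∑ a, ∑ j, F a j = ∑ j, ∑ a, F a j :=
      fun F => Finset.sum_comm
    have e2 : ∀ F : Fin q → Fin q → Fin k → ℝ,
        ∑ a, ∑ b, ∑ j, F a b j = ∑ j, ∑ a, ∑ b, F a b j := fun F => by
      simp_rw [e1]
    rw [e1, e2, ← Finset.sum_add_distrib]
    refine Finset.sum_congr rfl fun j _ => ?_
    split_ifs
    · simp only [mul_add, Finset.mul_sum]
      congr 1
      · exact Finset.sum_congr rfl fun a _ => by ring
      · exact Finset.sum_congr rfl fun a _ => Finset.sum_congr rfl fun b _ => by ring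
    · simp
  have h2 : ∑ y ∈ G0.support, ∑ j, (if z j = y then w j * taylorTwo φ y (x j - y) else 0)
      = ∑ j, w j * (if z j ∈ G0.support then taylorTwo φ (z j) (x j - z j) else 0) := by
    rw [Finset.sum_comm]
    refine Finset.sum_congr rfl fun j _ => ?_
    simp
  rw [h0, Finset.sum_congr rfl fun y _ => h1 y, h2]
  simp only [clusterRem, mul_sub, Finset.sum_sub_distrib]
  ring

section ClusterBounds

variable {q k : ℕ} {G0 : Euc q →₀ ℝ} {w : Fin k → ℝ} {x z : Fin k → Euc q}

theorem clusterSecond_self_nonneg (hw : ∀ j, 0 ≤ w j) (y : Euc q) (a : Fin q) :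
    0 ≤ clusterSecond w x z y a a :=
  Finset.sum_nonneg fun j _ => by
    split_ifs
    · exact mul_nonneg (hw j) (mul_nonneg (by norm_num) (mul_self_nonneg _))
    · exact le_rfl

theorem clusterScale_summand_le (hw : ∀ j, 0 ≤ w j) {y : Euc q} (hy : y ∈ G0.support) :
    ∑ a, |clusterFirst w x z y a| + ∑ a, clusterSecond w x z y a a ≤ clusterScale G0 w x z := by
  have h := Finset.single_le_sum
    (f := fun y => ∑ a, |clusterFirst w x z y a| + ∑ a, clusterSecond w x z y a a)
    (fun y _ => add_nonneg (Finset.sum_nonneg fun a _ => abs_nonneg _)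
      (Finset.sum_nonneg fun a _ => clusterSecond_self_nonneg hw y a)) hy
  exact h.trans (le_add_of_nonneg_left (Finset.sum_nonneg fun _ _ => abs_nonneg _))

theorem abs_clusterMass_le (hw : ∀ j, 0 ≤ w j) {y : Euc q} (hy : y ∈ Finset.univ.image z) :
    |clusterMass G0 w z y| ≤ clusterScale G0 w x z := by
  have h := Finset.single_le_sum (f := fun y => |clusterMass G0 w z y|)
    (fun y _ => abs_nonneg _) hy
  exact h.trans (le_add_of_nonneg_right (Finset.sum_nonneg fun y _ =>
    add_nonneg (Finset.sum_nonneg fun a _ => abs_nonneg _)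
      (Finset.sum_nonneg fun a _ => clusterSecond_self_nonneg hw y a)))

theorem abs_clusterFirst_le (hw : ∀ j, 0 ≤ w j) {y : Euc q} (hy : y ∈ G0.support) (a : Fin q) :
    |clusterFirst w x z y a| ≤ clusterScale G0 w x z := by
  refine le_trans ?_ (clusterScale_summand_le hw hy)
  have h := Finset.single_le_sum (f := fun a => |clusterFirst w x z y a|)
    (fun y _ => abs_nonneg _) (Finset.mem_univ a)
  exact h.trans (le_add_of_nonneg_right
    (Finset.sum_nonneg fun a _ => clusterSecond_self_nonneg hw y a))

theorem sum_clusterSecond_le (hw : ∀ j, 0 ≤ w j) {y : Euc q} (hy : y ∈ G0.support) :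
    ∑ a, clusterSecond w x z y a a ≤ clusterScale G0 w x z :=
  (le_add_of_nonneg_left (Finset.sum_nonneg fun _ _ => abs_nonneg _)).trans
    (clusterScale_summand_le hw hy)

theorem clusterSecond_self_le (hw : ∀ j, 0 ≤ w j) {y : Euc q} (hy : y ∈ G0.support)
    (a : Fin q) : clusterSecond w x z y a a ≤ clusterScale G0 w x z :=
  (Finset.single_le_sum (f := fun a => clusterSecond w x z y a a)
    (fun a _ => clusterSecond_self_nonneg hw y a) (Finset.mem_univ a)).trans
    (sum_clusterSecond_le hw hy)

theorem abs_clusterSecond_le (hw : ∀ j, 0 ≤ w j) {y : Euc q} (hy : y ∈ G0.support)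
    (a b : Fin q) : |clusterSecond w x z y a b| ≤ clusterScale G0 w x z := by
  have key : |clusterSecond w x z y a b|
      ≤ 1 / 2 * (clusterSecond w x z y a a + clusterSecond w x z y b b) := by
    refine (Finset.abs_sum_le_sum_abs _ _).trans ?_
    simp only [clusterSecond]
    rw [← Finset.sum_add_distrib, Finset.mul_sum]
    refine Finset.sum_le_sum fun j _ => ?_
    split_ifs
    · rw [abs_mul, abs_of_nonneg (hw j), ← mul_add, mul_left_comm (1 / 2 : ℝ) (w j)]
      refine mul_le_mul_of_nonneg_left ?_ (hw j)
      rw [abs_le]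
      constructor <;>
        nlinarith [sq_nonneg ((x j - y) a - (x j - y) b), sq_nonneg ((x j - y) a + (x j - y) b)]
    · simp
  have ha := clusterSecond_self_le (x := x) (z := z) hw hy a
  have hb := clusterSecond_self_le (x := x) (z := z) hw hy b
  linarith

theorem two_mul_sum_clusterSecond (y : Euc q) :
    2 * ∑ a, clusterSecond w x z y a a
      = ∑ j, if z j = y then w j * ‖x j - y‖ ^ 2 else 0 := by
  simp only [clusterSecond]
  rw [Finset.sum_comm, Finset.mul_sum]
  refine Finset.sum_congr rfl fun j _ => ?_
  split_ifs
  · rw [EuclideanSpace.real_norm_sq_eq, Finset.mul_sum, Finset.mul_sum]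
    exact Finset.sum_congr rfl fun a _ => by ring
  · simp

theorem mul_norm_sq_le_clusterScale (hw : ∀ j, 0 ≤ w j) {j : Fin k} (hj : z j ∈ G0.support) :
    w j * ‖x j - z j‖ ^ 2 ≤ 2 * clusterScale G0 w x z := by
  have h1 := two_mul_sum_clusterSecond (w := w) (x := x) (z := z) (z j)
  have h2 := sum_clusterSecond_le (x := x) (z := z) hw hj
  have h3 := Finset.single_le_sum
    (f := fun i => if z i = z j then w i * ‖x i - z j‖ ^ 2 else 0)
    (fun i _ => by
      split_ifs
      · exact mul_nonneg (hw i) (sq_nonneg _)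
      · exact le_rfl) (Finset.mem_univ j)
  simp only [if_true] at h3
  linarith

theorem weight_le_clusterScale (hw : ∀ j, 0 ≤ w j) {j : Fin k} (hj : z j ∉ G0.support) :
    w j ≤ clusterScale G0 w x z := by
  refine le_trans ?_ ((le_abs_self _).trans
    (abs_clusterMass_le hw (Finset.mem_image_of_mem z (Finset.mem_univ j))))
  rw [clusterMass, Finsupp.notMem_support_iff.1 hj, sub_zero]
  have h := Finset.single_le_sum (f := fun i => if z i = z j then w i else 0)
    (fun i _ => by
      split_ifs
      · exact hw i
      · exact le_rfl) (Finset.mem_univ j)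
  simpa using h

theorem Wpow_two_le_clusterScale {Θ : Set (Euc q)} {G : Euc q →₀ ℝ}
    (hG : IsMixingMeasure Θ G) (hG0 : IsMixingMeasure Θ G0) {D : ℝ} (hD : 0 ≤ D)
    (hdiam : ∀ x ∈ Θ, ∀ y ∈ Θ, ‖x - y‖ ^ 2 ≤ D) (hw : ∀ j, 0 ≤ w j)
    (hparam : ∀ f : Euc q → ℝ, ∑ z ∈ G.support, G z * f z = ∑ j, w j * f (x j))
    (hSz : G0.support ⊆ Finset.univ.image z) {ε : ℝ}
    (hsep : ∀ y ∈ Finset.univ.image z, ∀ y' ∈ Finset.univ.image z, ‖y - y'‖ < 2 * ε → y = y')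
    (hclose : ∀ j, ‖x j - z j‖ < ε) :
    Wpow 2 G G0 ≤ (2 + D) * clusterScale G0 w x z := by
  have hsep' : ∀ u, ∀ y ∈ Finset.univ.image z, ∀ y' ∈ Finset.univ.image z,
      ‖u - y‖ < ε → ‖u - y'‖ < ε → y = y' := by
    intro u y hy y' hy' h h'
    refine hsep y hy y' hy' ?_
    calc ‖y - y'‖ = ‖(u - y') - (u - y)‖ := by congr 1; abel
      _ ≤ ‖u - y'‖ + ‖u - y‖ := norm_sub_le _ _
      _ < 2 * ε := by linarith
  have hiff : ∀ y ∈ G0.support, ∀ j, ‖x j - y‖ < ε ↔ z j = y := fun y hy j =>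
    ⟨fun h => hsep' (x j) _ (Finset.mem_image_of_mem z (Finset.mem_univ j)) _ (hSz hy)
      (hclose j) h, fun h => h ▸ hclose j⟩
  refine (Wpow_two_le_of_near hG hG0 hD hdiam (ε := ε) fun u y hy y' hy' =>
    hsep' u y (hSz hy) y' (hSz hy')).trans ?_
  have h1 : ∀ y ∈ G0.support, ∑ u ∈ G.support, G u * (if ‖u - y‖ < ε then ‖u - y‖ ^ 2 else 0)
      = 2 * ∑ a, clusterSecond w x z y a a := by
    intro y hy
    rw [hparam fun u => if ‖u - y‖ < ε then ‖u - y‖ ^ 2 else 0, two_mul_sum_clusterSecond]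
    simp only [hiff y hy, mul_ite, mul_zero]
  have h2 : ∀ y ∈ G0.support, |∑ u ∈ G.support, G u * (if ‖u - y‖ < ε then 1 else 0) - G0 y|
      = |clusterMass G0 w z y| := by
    intro y hy
    rw [hparam fun u => if ‖u - y‖ < ε then 1 else 0, clusterMass]
    simp only [hiff y hy, mul_ite, mul_zero, mul_one]
  rw [Finset.sum_congr rfl h1, Finset.sum_congr rfl h2, add_mul, ← Finset.mul_sum]
  have hmass : ∑ y ∈ G0.support, |clusterMass G0 w z y|
      ≤ ∑ y ∈ Finset.univ.image z, |clusterMass G0 w z y| :=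
    Finset.sum_le_sum_of_subset_of_nonneg hSz fun _ _ _ => abs_nonneg _
  have hfirst : 0 ≤ ∑ y ∈ G0.support, ∑ a, |clusterFirst w x z y a| :=
    Finset.sum_nonneg fun _ _ => Finset.sum_nonneg fun _ _ => abs_nonneg _
  have hsecond : 0 ≤ ∑ y ∈ G0.support, ∑ a, clusterSecond w x z y a a :=
    Finset.sum_nonneg fun _ _ => Finset.sum_nonneg fun _ _ => clusterSecond_self_nonneg hw _ _
  have hmass0 : 0 ≤ ∑ y ∈ G0.support, |clusterMass G0 w z y| :=
    Finset.sum_nonneg fun _ _ => abs_nonneg _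
  have hscale : clusterScale G0 w x z = ∑ y ∈ Finset.univ.image z, |clusterMass G0 w z y|
      + (∑ y ∈ G0.support, ∑ a, |clusterFirst w x z y a|
        + ∑ y ∈ G0.support, ∑ a, clusterSecond w x z y a a) := by
    rw [clusterScale, Finset.sum_add_distrib]
  gcongr <;> linarith

end ClusterBounds

theorem Ultrafilter.exists_tendsto_of_eventually_abs_le {ι : Type*} (U : Ultrafilter ι)
    {f : ι → ℝ} {C : ℝ} (h : ∀ᶠ n in U, |f n| ≤ C) : ∃ a, Tendsto f U (𝓝 a) := by
  obtain ⟨a, -, ha⟩ := (isCompact_Icc (a := -C) (b := C)).ultrafilter_le_nhds (U.map f)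
    (by
      rw [le_principal_iff]
      exact h.mono fun n hn => abs_le.1 hn)
  exact ⟨a, ha⟩

theorem Finset.exists_pos_separation {E : Type*} [NormedAddCommGroup E] (L : Finset E) :
    ∃ ε > 0, ∀ y ∈ L, ∀ y' ∈ L, ‖y - y'‖ < 2 * ε → y = y' := by
  have h : ∀ᶠ ε in 𝓝[>] (0 : ℝ), ∀ y ∈ L, ∀ y' ∈ L, ‖y - y'‖ < 2 * ε → y = y' := by
    rw [Filter.eventually_all_finset]
    intro y _
    rw [Filter.eventually_all_finset]
    intro y' _
    by_cases hne : y = y'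
    · exact Eventually.of_forall fun _ _ => hne
    · have hpos : 0 < ‖y - y'‖ / 2 := half_pos (norm_pos_iff.2 (sub_ne_zero.2 hne))
      filter_upwards [Ioo_mem_nhdsGT hpos] with ε hε hlt
      linarith [hε.2]
  obtain ⟨ε, h, hε⟩ := (h.and self_mem_nhdsWithin).exists
  exact ⟨ε, hε, h⟩

/-- The weighted expansion remainder is negligible with respect to the coefficients. -/
theorem tendsto_mul_clusterRem_div {q k : ℕ} {l : Filter ℕ} {Θ : Set (Euc q)} {G0 : Euc q →₀ ℝ}
    {φ : Euc q → ℝ} (hcont : ContinuousOn φ Θ) (hsmooth : ∀ y ∈ G0.support, ContDiffAt ℝ 2 φ y)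
    {w : ℕ → Fin k → ℝ} (hw : ∀ n j, 0 ≤ w n j) {x : ℕ → Fin k → Euc q} {z : Fin k → Euc q}
    {j : Fin k} (hxΘ : ∀ n, x n j ∈ Θ) (hzΘ : z j ∈ Θ)
    (hlim : Tendsto (fun n => x n j) l (𝓝 (z j))) :
    Tendsto (fun n => w n j * clusterRem G0 φ (x n j) (z j) / clusterScale G0 (w n) (x n) z)
      l (𝓝 0) := by
  refine IsLittleO.tendsto_div_nhds_zero ?_
  by_cases hj : z j ∈ G0.support
  · have hrem : (fun n => clusterRem G0 φ (x n j) (z j)) =o[l] fun n => ‖x n j - z j‖ ^ 2 := by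
      refine ((hsmooth _ hj).isLittleO_taylor_two.comp_tendsto hlim).congr_left fun n => ?_
      simp only [Function.comp, clusterRem, hj, if_true, taylorTwo]
      rw [clm_apply_eq_sum (fderiv ℝ φ (z j)), clm_apply_apply_eq_sum]
      ring
    refine ((isBigO_refl (fun n => w n j) l).mul_isLittleO hrem).trans_isBigO ?_
    refine IsBigO.of_bound 2 (Eventually.of_forall fun n => ?_)
    rw [Real.norm_of_nonneg (mul_nonneg (hw n j) (sq_nonneg _))]
    refine (mul_norm_sq_le_clusterScale (hw n) hj).trans ?_
    gcongr
    exact le_abs_self _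
  · have hrem : Tendsto (fun n => clusterRem G0 φ (x n j) (z j)) l (𝓝 0) := by
      have h : Tendsto (fun n => φ (x n j)) l (𝓝 (φ (z j))) :=
        (hcont _ hzΘ).tendsto.comp
          (tendsto_nhdsWithin_iff.2 ⟨hlim, Eventually.of_forall hxΘ⟩)
      simpa [clusterRem, hj] using h.sub_const (φ (z j))
    have h1 := (isBigO_refl (fun n => w n j) l).mul_isLittleO ((isLittleO_one_iff ℝ).2 hrem)
    refine h1.trans_isBigO (IsBigO.of_bound 1 (Eventually.of_forall fun n => ?_))
    rw [mul_one, one_mul, Real.norm_of_nonneg (hw n j)]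
    exact (weight_le_clusterScale (hw n) hj).trans (le_abs_self _)

/-- Atoms of `G0` are limits of atoms of measures converging to `G0` in `W₁`. -/
theorem mem_image_of_tendsto_Wpow_one {q k : ℕ} {l : Filter ℕ} [l.NeBot] {Θ : Set (Euc q)}
    {G0 : Euc q →₀ ℝ} (hG0 : IsMixingMeasure Θ G0) {G : ℕ → Euc q →₀ ℝ}
    (hG : ∀ n, IsMixingMeasure Θ (G n)) (hW : ∀ ε > 0, ∀ᶠ n in l, Wpow 1 (G n) G0 < ε)
    {x : ℕ → Fin k → Euc q} {z : Fin k → Euc q} (hx : ∀ n, ∀ u ∈ (G n).support, ∃ j, x n j = u)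
    (hlim : ∀ j, Tendsto (fun n => x n j) l (𝓝 (z j))) :
    G0.support ⊆ Finset.univ.image z := by
  intro y hy
  by_contra hyz
  obtain ⟨ε, hε, hball⟩ := Metric.isOpen_iff.1
    (Finset.univ.image z).finite_toSet.isClosed.isOpen_compl y (by simpa using hyz)
  have hfar : ∀ᶠ n in l, ∀ j, ε / 2 < ‖x n j - y‖ := by
    rw [eventually_all]
    intro j
    refine ((hlim j).sub_const y).norm.eventually_const_lt ?_
    by_contra! h
    have hmem : z j ∈ Metric.ball y ε := by
      rw [Metric.mem_ball, dist_eq_norm]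
      linarith
    exact hball hmem (by simp)
  obtain ⟨n, hn, hn'⟩ := (hfar.and (hW (ε / 2 * G0 y) (mul_pos (half_pos hε) (hG0.1 y hy)))).exists
  refine absurd (mul_le_Wpow_one (hG n) hG0 hy fun u hu => ?_) (not_le.2 hn')
  obtain ⟨j, rfl⟩ := hx n u hu
  exact (hn j).le

end

open Filter Topology in
/-- if `Φ` is a `(G0,k)` second-order linear independent domain and `Θ`
is compact, then the inverse bound with one argument fixed,
`sup_φ |Gφ - G0φ| ≥ c W_2(G,G0)²`, holds near `G0`. -/
theorem inverse_bound_one_argument_fixed {q k k0 : ℕ} (hk0 : 1 ≤ k0) (hk0k : k0 ≤ k)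
    (Θ : Set (Euc q)) (hΘ : IsCompact Θ)
    (Φ : Set (Euc q → ℝ)) (hcont : ∀ φ ∈ Φ, ContinuousOn φ Θ)
    (G0 : Euc q →₀ ℝ) (hG0 : MixE Θ k0 G0)
    (hsmooth : ∀ φ ∈ Φ, ∀ x ∈ G0.support, ContDiffAt ℝ 2 φ x)
    (hind : ∀ ℓ1 ℓ : ℕ, 1 ≤ ℓ1 → ℓ1 ≤ k0 → k0 ≤ ℓ → ℓ ≤ k →
      ∀ θ : Fin ℓ → Euc q, Function.Injective θ →
        (∀ i : Fin ℓ, (i : ℕ) < k0 → θ i ∈ G0.support) →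
        (∀ i : Fin ℓ, k0 ≤ (i : ℕ) → θ i ∈ Θ ∧ θ i ∉ G0.support) →
      ∀ a : Fin ℓ → (Fin q → ℕ) → ℝ,
        (∀ φ ∈ Φ, ∑ i : Fin ℓ,
            ∑ α ∈ multiIdx q (if (i : ℕ) < ℓ1 then 2 else if (i : ℕ) < k0 then 1 else 0),
              a i α * Dmulti α φ (θ i) = 0) →
        (∑ i : Fin ℓ, a i 0 = 0) →
        ∀ i : Fin ℓ,
          ∀ α ∈ multiIdx q (if (i : ℕ) < ℓ1 then 2 else if (i : ℕ) < k0 then 1 else 0),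
            a i α = 0) :
    ∃ r > (0:ℝ), ∃ c > (0:ℝ), ∀ G : Euc q →₀ ℝ, MixG Θ k G → Wpow 1 G G0 ≤ r →
      ENNReal.ofReal (c * Wpow 2 G G0) ≤ phiDist Φ G G0 := by
  classical
  by_contra! hcon
  have hpos : ∀ n : ℕ, (0 : ℝ) < 1 / (n + 1) := fun n => Nat.one_div_pos_of_nat
  choose G hG hW1 hlt using fun n : ℕ => hcon (1 / (n + 1)) (hpos n) (1 / (n + 1)) (hpos n)
  have hW2 : ∀ n, 0 < Wpow 2 (G n) G0 := by
    intro n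
    have h := ENNReal.ofReal_pos.1 (zero_le.trans_lt (hlt n))
    exact (mul_pos_iff_of_pos_left (hpos n)).1 h
  have hφ : ∀ n, ∀ φ ∈ Φ,
      |mixInt (G n) φ - mixInt G0 φ| ≤ 1 / ((n : ℝ) + 1) * Wpow 2 (G n) G0 := by
    intro n φ hφ
    have h := (le_iSup₂ (f := fun φ (_ : φ ∈ Φ) =>
      ENNReal.ofReal |mixInt (G n) φ - mixInt G0 φ|) φ hφ).trans (hlt n).le
    exact (ENNReal.ofReal_le_ofReal_iff (mul_pos (hpos n) (hW2 n)).le).1 h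
  choose w x hw hxsupp hxsurj hparam using fun n => (hG n).1.exists_fin_param (hG n).2
  have hxΘ : ∀ n j, x n j ∈ Θ := fun n j => (hG n).1.2.2 (hxsupp n j)
  set U : Ultrafilter ℕ := hyperfilter ℕ with hU
  have hUtop : (U : Filter ℕ) ≤ atTop := Nat.hyperfilter_le_atTop
  have hinv : Tendsto (fun n : ℕ => 1 / ((n : ℝ) + 1)) U (𝓝 0) :=
    tendsto_one_div_add_atTop_nhds_zero_nat.mono_left hUtop
  have hlimex : ∀ j, ∃ z ∈ Θ, Tendsto (fun n => x n j) U (𝓝 z) := fun j =>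
    hΘ.ultrafilter_le_nhds (U.map fun n => x n j)
      (tendsto_principal.2 (Eventually.of_forall fun n => hxΘ n j))
  choose z hzΘ hlim using hlimex
  set L : Finset (Euc q) := Finset.univ.image z with hL
  have hSL : G0.support ⊆ L := mem_image_of_tendsto_Wpow_one hG0.1 (fun n => (hG n).1)
    (fun ε hε => (hinv.eventually_lt_const hε).mono fun n hn => (hW1 n).trans_lt hn) hxsurj hlim
  have hLcard : L.card ≤ k := Finset.card_image_le.trans (by simp)
  have hLΘ : ∀ y ∈ L, y ∈ Θ := by
    intro y hy
    obtain ⟨j, -, rfl⟩ := Finset.mem_image.1 hy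
    exact hzΘ j
  obtain ⟨R, hR⟩ := hΘ.isBounded.exists_norm_le
  have hdiam : ∀ u ∈ Θ, ∀ v ∈ Θ, ‖u - v‖ ^ 2 ≤ (2 * R) ^ 2 := by
    intro u hu v hv
    gcongr
    linarith [norm_sub_le u v, hR u hu, hR v hv]
  obtain ⟨ε, hε, hsep⟩ := L.exists_pos_separation
  set M : ℕ → ℝ := fun n => clusterScale G0 (w n) (x n) z with hM
  have hWM : ∀ᶠ n in U, Wpow 2 (G n) G0 ≤ (2 + (2 * R) ^ 2) * M n := by
    have hclose : ∀ᶠ n in U, ∀ j, ‖x n j - z j‖ < ε := by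
      rw [eventually_all]
      intro j
      have h := ((hlim j).sub_const (z j)).norm
      rw [sub_self, norm_zero] at h
      exact h.eventually_lt_const hε
    filter_upwards [hclose] with n hn
    exact Wpow_two_le_clusterScale (hG n).1 hG0.1 (sq_nonneg _) hdiam (hw n) (hparam n) hSL hsep hn
  have hMpos : ∀ᶠ n in U, 0 < M n := hWM.mono fun n hn =>
    (mul_pos_iff_of_pos_left (by positivity)).1 ((hW2 n).trans_le hn)
  have hbdd : ∀ f : ℕ → ℝ, (∀ n, |f n| ≤ M n) → ∃ a, Tendsto (fun n => f n / M n) U (𝓝 a) :=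
    fun f hf => U.exists_tendsto_of_eventually_abs_le (C := 1) (hMpos.mono fun n hn => by
      rw [abs_div, abs_of_pos hn]
      exact (div_le_one hn).2 (hf n))
  choose! α hα using fun y (hy : y ∈ L) =>
    hbdd (fun n => clusterMass G0 (w n) z y) fun n => abs_clusterMass_le (hw n) hy
  choose! β hβ using fun y (hy : y ∈ G0.support) a =>
    hbdd (fun n => clusterFirst (w n) (x n) z y a) fun n => abs_clusterFirst_le (hw n) hy a
  choose! γ hγ using fun y (hy : y ∈ G0.support) a b =>
    hbdd (fun n => clusterSecond (w n) (x n) z y a b) fun n => abs_clusterSecond_le (hw n) hy a b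
  have hzero : ∀ φ ∈ Φ, ∑ y ∈ L, α y * φ y
      + ∑ y ∈ G0.support, (∑ a, β y a * fderiv ℝ φ y (EuclideanSpace.single a 1)
        + ∑ a, ∑ b, γ y a b * fderiv ℝ (fderiv ℝ φ) y
          (EuclideanSpace.single a 1) (EuclideanSpace.single b 1)) = 0 := by
    intro φ hφΦ
    have hleft : Tendsto (fun n => (mixInt (G n) φ - mixInt G0 φ) / M n) U (𝓝 0) := by
      refine squeeze_zero_norm' (a := fun n : ℕ => 1 / ((n : ℝ) + 1) * (2 + (2 * R) ^ 2)) ?_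
        (by simpa using hinv.mul_const (2 + (2 * R) ^ 2))
      filter_upwards [hMpos, hWM] with n hn hn'
      rw [norm_div, Real.norm_eq_abs, Real.norm_of_nonneg hn.le, div_le_iff₀ hn, mul_assoc]
      exact (hφ n φ hφΦ).trans (mul_le_mul_of_nonneg_left hn' (hpos n).le)
    have hrem : Tendsto (fun n => ∑ j, w n j * clusterRem G0 φ (x n j) (z j) / M n) U (𝓝 0) := by
      rw [← Finset.sum_const_zero (ι := Fin k) (s := Finset.univ)]
      exact tendsto_finsetSum _ fun j _ => tendsto_mul_clusterRem_div (hcont φ hφΦ)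
        (hsmooth φ hφΦ) hw (fun n => hxΘ n j) (hzΘ j) (hlim j)
    have hcoef := (tendsto_finsetSum L fun y hy => (hα y hy).mul_const (φ y)).add
      (tendsto_finsetSum G0.support fun y hy =>
        (tendsto_finsetSum Finset.univ fun a _ =>
          (hβ y hy a).mul_const (fderiv ℝ φ y (EuclideanSpace.single a 1))).add
        (tendsto_finsetSum Finset.univ fun a _ => tendsto_finsetSum Finset.univ fun b _ =>
          (hγ y hy a b).mul_const (fderiv ℝ (fderiv ℝ φ) y
            (EuclideanSpace.single a 1) (EuclideanSpace.single b 1))))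
    have hright := hcoef.add hrem
    rw [add_zero] at hright
    refine tendsto_nhds_unique (hright.congr fun n => ?_) hleft
    have hexp := cluster_expansion (w := w n) (x := x n) hSL φ
    simp only [mixInt]
    rw [hparam n φ, hexp]
    simp only [div_mul_eq_mul_div, ← Finset.sum_div, ← add_div]
    rfl
  have hαsum : ∑ y ∈ L, α y = 0 := by
    refine tendsto_nhds_unique (tendsto_finsetSum L hα) ?_
    refine tendsto_const_nhds.congr fun n => ?_
    rw [← Finset.sum_div, eq_comm, div_eq_zero_iff]
    left
    simp only [clusterMass, Finset.sum_sub_distrib]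
    rw [Finset.sum_comm, ← Finset.sum_subset hSL
      (fun y _ hy => Finsupp.notMem_support_iff.1 hy), hG0.1.2.1, sub_eq_zero]
    have h1 := hparam n fun _ => 1
    simp only [mul_one] at h1
    rw [← (hG n).1.2.1, h1]
    exact Finset.sum_congr rfl fun j _ => by simp [hL]
  obtain ⟨hα0, hS0⟩ := jet_coeff_eq_zero hk0 hG0.2 hsmooth hind hSL hLΘ hLcard α β γ hzero hαsum
  have hone : Tendsto (fun n => M n / M n) U (𝓝 1) :=
    tendsto_const_nhds.congr' (hMpos.mono fun n hn => (div_self hn.ne').symm)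
  have hlimM := (tendsto_finsetSum L fun y hy => (hα y hy).abs).add
      (tendsto_finsetSum G0.support fun y hy =>
        (tendsto_finsetSum Finset.univ fun a _ => (hβ y hy a).abs).add
        (tendsto_finsetSum Finset.univ fun a _ => hγ y hy a a))
  have hval : ∑ y ∈ L, |α y| + ∑ y ∈ G0.support, (∑ a, |β y a| + ∑ a, γ y a a) = 0 := by
    rw [Finset.sum_eq_zero fun y hy => by rw [hα0 y hy, abs_zero], zero_add]
    exact Finset.sum_eq_zero fun y hy => by simp [(hS0 y hy).1, (hS0 y hy).2]
  rw [hval] at hlimM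
  refine zero_ne_one (tendsto_nhds_unique (hlimM.congr' ?_) hone)
  filter_upwards [hMpos] with n hn
  simp only [abs_div, abs_of_pos hn, ← Finset.sum_div, ← add_div]
  rfl

end
end
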